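/- arXiv:1505.00666 — 3 statements merged into one kernel-verified Lean document; each statement's English description precedes it below -/
import Mathlib

section
/- Let C : f = 0 be a nearly free reduced plane curve of degree d with exponents (d1, d2). Then N(f)_k ≠ 0 (in fact dim_ℂ N(f)_k = 1) for every k with d + d1 − 3 ≤ k ≤ d + d2 − 3, and N(f)_k = 0 for all other k. -/
open MvPolynomial

noncomputable section

/-- The polynomial ring `S = ℂ[x,y,z]`. -/
abbrev S : Type := MvPolynomial (Fin 3) ℂ

/-- The Jacobian ideal of `f`, spanned by the three partial derivatives. -/
def Jf (f : S) : Ideal S := Ideal.span {pderiv 0 f, pderiv 1 f, pderiv 2 f}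

/-- The irrelevant maximal ideal `m = (x,y,z)`. -/
def mId : Ideal S := Ideal.span {X 0, X 1, X 2}

/-- The saturation `I_f` of the Jacobian ideal with respect to `m`. -/
def Isat (f : S) : Ideal S := ⨆ n : ℕ, Submodule.colon (Jf f) ((mId ^ n : Ideal S) : Submodule S S)

/-- The quotient map `S → M(f) = S/J_f`, as a `ℂ`-linear map. -/
def quotC (f : S) : S →ₗ[ℂ] (S ⧸ (Jf f : Submodule S S)) :=
  ((Jf f : Submodule S S).mkQ).restrictScalars ℂ

/-- Degree-`k` homogeneous component of `S`, as a `ℂ`-subspace. -/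
def Sgr (k : ℕ) : Submodule ℂ S := homogeneousSubmodule (Fin 3) ℂ k

/-- The degree-`k` part of the Milnor algebra `M(f)`. -/
def Msub (f : S) (k : ℕ) : Submodule ℂ (S ⧸ (Jf f : Submodule S S)) := (Sgr k).map (quotC f)

/-- `m(f)_k`, the dimension of the degree-`k` part of the Milnor algebra. -/
def mdim (f : S) (k : ℕ) : ℕ := Module.finrank ℂ (Msub f k)

/-- The degree-`k` part of the Jacobian module `N(f) = I_f/J_f`, realized inside `S/J_f`. -/
def Nsub (f : S) (k : ℕ) : Submodule ℂ (S ⧸ (Jf f : Submodule S S)) :=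
  (((Isat f).restrictScalars ℂ) ⊓ Sgr k).map (quotC f)

/-- `dim_ℂ N(f)_k`. -/
def ndim (f : S) (k : ℕ) : ℕ := Module.finrank ℂ (Nsub f k)

/-- The Jacobian module `N(f) = I_f/J_f`, as an `S`-submodule of `S/J_f`. -/
def Nmod (f : S) : Submodule S (S ⧸ (Jf f : Submodule S S)) :=
  Submodule.map ((Jf f : Submodule S S).mkQ) (Isat f : Submodule S S)

/-- The Jacobian module `N(f)` as a `ℂ`-subspace of `S/J_f`. -/
def NsubTot (f : S) : Submodule ℂ (S ⧸ (Jf f : Submodule S S)) :=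
  ((Isat f).restrictScalars ℂ).map (quotC f)

/-- `dim_ℂ N(f)`. -/
def ndimTot (f : S) : ℕ := Module.finrank ℂ (NsubTot f)

/-- `C : f = 0` is nearly free: `N(f) ≠ 0` and `dim N(f)_k ≤ 1` for all `k`. -/
def NearlyFree (f : S) : Prop := Nmod f ≠ ⊥ ∧ ∀ k : ℕ, ndim f k ≤ 1

/-- `f` defines a union of lines passing through one point. -/
def IsConeOfLines (f : S) : Prop :=
  ∃ q : Fin 3 → ℂ, q ≠ 0 ∧ ∃ (c : ℂ) (L : Multiset S),
    (∀ l ∈ L, l ∈ Sgr 1 ∧ eval q l = 0) ∧ f = C c * L.prod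

/-- The defining equation map `(a,b,c) ↦ a f_x + b f_y + c f_z`. -/
def eqnMap (f : S) : (Fin 3 → S) →ₗ[S] S where
  toFun r := ∑ i, r i * pderiv i f
  map_add' a b := by simp [add_mul, Finset.sum_add_distrib]
  map_smul' c a := by simp [Finset.mul_sum, mul_assoc]

/-- `AR(f)`, the module of all relations among the partial derivatives of `f`. -/
def ARmod (f : S) : Submodule S (Fin 3 → S) := LinearMap.ker (eqnMap f)

/-- A triple of polynomials is homogeneous of degree `m` (componentwise). -/
def IsHomRel (r : Fin 3 → S) (m : ℕ) : Prop := ∀ i, r i ∈ Sgr m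

/-- The set of degrees of nonzero homogeneous relations in `AR(f)`;
its least element is `mdr(f)`. -/
def mdrSet (f : S) : Set ℕ := {m | ∃ r ∈ ARmod f, r ≠ 0 ∧ IsHomRel r m}

/-- The map `(u₁,u₂,u₃) ↦ u₁ r₁ + u₂ r₂ + u₃ r₃` whose kernel is the syzygy
module among `r₁, r₂, r₃`. -/
def syzMap (r : Fin 3 → (Fin 3 → S)) : (Fin 3 → S) →ₗ[S] (Fin 3 → S) where
  toFun u := ∑ j, u j • r j
  map_add' a b := by simp [add_smul, Finset.sum_add_distrib]
  map_smul' c a := by simp [Finset.smul_sum, smul_smul]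

/-- `M(f)` has a minimal graded free resolution
`0 → S(−b−2(d−1)) → ⊕ᵢ S(−dᵢ−(d−1)) → S(−d+1)³ → S`; equivalently, `AR(f)` is
generated by three homogeneous relations of degrees `d₁, d₂, d₃`, none lying in
the submodule spanned by the other two, whose syzygy module is free of rank one,
generated by a homogeneous triple `(v₁,v₂,v₃)` with `deg vᵢ = b − dᵢ + d − 1`. -/
def HasResolution (f : S) (d : ℕ) (dd : Fin 3 → ℕ) (b : ℤ) : Prop :=
  ∃ r : Fin 3 → (Fin 3 → S),
    (∀ j, r j ∈ ARmod f) ∧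
    (∀ j, IsHomRel (r j) (dd j)) ∧
    Submodule.span S (Set.range r) = ARmod f ∧
    (∀ j, r j ∉ Submodule.span S (r '' {k | k ≠ j})) ∧
    ∃ v : Fin 3 → S, v ≠ 0 ∧
      (∀ j, ∃ e : ℕ, (e : ℤ) = b - dd j + d - 1 ∧ v j ∈ Sgr e) ∧
      LinearMap.ker (syzMap r) = Submodule.span S {v}

/-- The Hilbert function of the Milnor algebra of a smooth plane curve of
degree `d`: the coefficient of `t^k` in `((1 − t^{d−1})/(1 − t))³`. -/
def msHilb (d k : ℕ) : ℕ :=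
  (((∑ i ∈ Finset.range (d - 1), (Polynomial.X : Polynomial ℕ) ^ i)) ^ 3).coeff k

/-- `τ` is the total Tjurina number of `C : f = 0`, i.e. the common value of
`m(f)_k` for all sufficiently large `k`. -/
def TjurinaIs (f : S) (τ : ℕ) : Prop := ∃ N : ℕ, ∀ k ≥ N, mdim f k = τ


lemma mem_Jf_iff (f g : S) : g ∈ Jf f ↔ ∃ u, eqnMap f u = g := by
  unfold Jf
  rw [Ideal.mem_span_insert]
  constructor
  · rintro ⟨a, z, hz, rfl⟩
    rw [Ideal.mem_span_pair] at hz
    obtain ⟨b, c, rfl⟩ := hz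
    refine ⟨![a, b, c], ?_⟩
    simp [eqnMap, Fin.sum_univ_three, add_assoc]
  · rintro ⟨u, rfl⟩
    refine ⟨u 0, u 1 * pderiv 1 f + u 2 * pderiv 2 f, ?_, ?_⟩
    · rw [Ideal.mem_span_pair]
      exact ⟨_, _, rfl⟩
    · simp [eqnMap, Fin.sum_univ_three, add_assoc]

/-- Koszul-exact triple. -/
structure Reg3 (A B C : S) : Prop where
  a0 : A ≠ 0
  b0 : B ≠ 0
  rp : IsRelPrime A B
  k1 : ∀ x a b, C * x = A * a + B * b → ∃ a' b', x = A * a' + B * b'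

lemma Reg3.k2 {A B C : S} (h : Reg3 A B C) {a b : S} (e : B * a = A * b) :
    ∃ c, a = A * c ∧ b = B * c := by
  have : A ∣ a := h.rp.dvd_of_dvd_mul_left ⟨b, e⟩
  obtain ⟨c, rfl⟩ := this
  refine ⟨c, rfl, mul_left_cancel₀ h.a0 ?_⟩
  rw [← e]; ring

lemma Reg3.koszul {A B C : S} (h : Reg3 A B C) {p1 p2 p3 : S}
    (e : C * p1 - B * p2 + A * p3 = 0) :
    ∃ t1 t2 t3, p1 = B * t1 - A * t2 ∧ p2 = C * t1 - A * t3 ∧ p3 = C * t2 - B * t3 := by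
  obtain ⟨a', b', hx⟩ := h.k1 p1 (-p3) p2 (by linear_combination e)
  have : B * (C * b' - p2) = A * (-(p3 + C * a')) := by
    subst hx; linear_combination e
  obtain ⟨c, h1, h2⟩ := h.k2 this
  refine ⟨b', -a', c, ?_, ?_, ?_⟩
  · rw [hx]; ring
  · linear_combination -h1
  · linear_combination -h2

lemma Reg3.k2v {ι : Type} {A B C : S} (h : Reg3 A B C) {a b : ι → S} (e : B • a = A • b) :
    ∃ c : ι → S, a = A • c ∧ b = B • c := by
  have := fun i => h.k2 (a := a i) (b := b i) (by simpa using congrFun e i)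
  choose c h1 h2 using this
  exact ⟨c, funext h1, funext h2⟩

lemma Reg3.koszulv {ι : Type} {A B C : S} (h : Reg3 A B C) {p1 p2 p3 : ι → S}
    (e : C • p1 - B • p2 + A • p3 = 0) :
    ∃ t1 t2 t3 : ι → S, p1 = B • t1 - A • t2 ∧ p2 = C • t1 - A • t3 ∧ p3 = C • t2 - B • t3 := by
  have := fun i => h.koszul (p1 := p1 i) (p2 := p2 i) (p3 := p3 i) (by simpa using congrFun e i)
  choose t1 t2 t3 h1 h2 h3 using this
  exact ⟨t1, t2, t3, funext h1, funext h2, funext h3⟩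

lemma Reg3.powA {A B C : S} (h : Reg3 A B C) (n : ℕ) : Reg3 (A ^ n) B C := by
  have a0 := h.a0
  refine ⟨pow_ne_zero _ h.a0, h.b0, h.rp.pow_left, ?_⟩
  induction n with
  | zero => intro x a b _; exact ⟨x, 0, by simp⟩
  | succ n ih =>
    intro x a b e
    obtain ⟨a', b', rfl⟩ := h.k1 x (A ^ n * a) b (by rw [e]; ring)
    have : B * (b - C * b') = A * (C * a' - A ^ n * a) := by linear_combination -e
    obtain ⟨c, h1, h2⟩ := h.k2 this
    obtain ⟨a2, b2, rfl⟩ := ih a' a c (by linear_combination h2)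
    exact ⟨a2, A * b2 + b', by ring⟩

lemma Reg3.swap {A B C : S} (h : Reg3 A B C) : Reg3 B A C := by
  refine ⟨h.b0, h.a0, h.rp.symm, ?_⟩
  intro x a b e
  obtain ⟨a', b', rfl⟩ := h.k1 x b a (by rw [e]; ring)
  exact ⟨b', a', by ring⟩

lemma Reg3.pow {A B C : S} (h : Reg3 A B C) (n m : ℕ) : Reg3 (A ^ n) (B ^ m) C :=
  (((h.powA n).swap).powA m).swap

section Dat
variable {ι : Type} (f : S) (R : (ι → S) →ₗ[S] (Fin 3 → S)) (ρ : ι → S)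

/-- Chase data. -/
def Dat (A B C g w : S) : Prop := ∃ (u1 u2 u3 : Fin 3 → S) (p1 p2 p3 : ι → S),
  A * g = eqnMap f u1 ∧ B * g = eqnMap f u2 ∧ C * g = eqnMap f u3 ∧
  B • u1 - A • u2 = R p1 ∧ C • u1 - A • u3 = R p2 ∧ C • u2 - B • u3 = R p3 ∧
  C • p1 - B • p2 + A • p3 = w • ρ

variable {f R ρ}

lemma Dat.exists (hR : LinearMap.range R = ARmod f) (hk : LinearMap.ker R = Submodule.span S {ρ})
    {A B C g : S} (hA : A * g ∈ Jf f) (hB : B * g ∈ Jf f) (hC : C * g ∈ Jf f) :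
    ∃ w, Dat f R ρ A B C g w := by
  obtain ⟨u1, h1⟩ := (mem_Jf_iff _ _).1 hA
  obtain ⟨u2, h2⟩ := (mem_Jf_iff _ _).1 hB
  obtain ⟨u3, h3⟩ := (mem_Jf_iff _ _).1 hC
  have key : ∀ (A B : S) (u v), eqnMap f u = A * g → eqnMap f v = B * g →
      ∃ p, B • u - A • v = R p := by
    intro A B u v hu hv
    have : B • u - A • v ∈ LinearMap.range R := by
      rw [hR, ARmod, LinearMap.mem_ker, map_sub, map_smul, map_smul, hu, hv, smul_eq_mul,
        smul_eq_mul]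
      ring
    obtain ⟨p, hp⟩ := this
    exact ⟨p, hp.symm⟩
  obtain ⟨p1, e1⟩ := key A B u1 u2 h1 h2
  obtain ⟨p2, e2⟩ := key A C u1 u3 h1 h3
  obtain ⟨p3, e3⟩ := key B C u2 u3 h2 h3
  have : C • p1 - B • p2 + A • p3 ∈ LinearMap.ker R := by
    rw [LinearMap.mem_ker, map_add, map_sub, map_smul, map_smul, map_smul, ← e1, ← e2, ← e3]
    ext i : 1
    simp; ring
  rw [hk, Submodule.mem_span_singleton] at this
  obtain ⟨w, hw⟩ := this
  exact ⟨w, u1, u2, u3, p1, p2, p3, h1.symm, h2.symm, h3.symm, e1, e2, e3, hw.symm⟩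

lemma Dat.smul {A B C g w : S} (h : Dat f R ρ A B C g w) (q : S) :
    Dat f R ρ A B C (q * g) (q * w) := by
  obtain ⟨u1, u2, u3, p1, p2, p3, h1, h2, h3, e1, e2, e3, e4⟩ := h
  refine ⟨q • u1, q • u2, q • u3, q • p1, q • p2, q • p3, ?_, ?_, ?_, ?_, ?_, ?_, ?_⟩
  · rw [map_smul, ← h1, smul_eq_mul]; ring
  · rw [map_smul, ← h2, smul_eq_mul]; ring
  · rw [map_smul, ← h3, smul_eq_mul]; ring
  · rw [map_smul, ← e1]; module
  · rw [map_smul, ← e2]; module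
  · rw [map_smul, ← e3]; module
  · rw [mul_smul, ← e4]; module

lemma Dat.sub {A B C g w g' w' : S} (h : Dat f R ρ A B C g w) (h' : Dat f R ρ A B C g' w') :
    Dat f R ρ A B C (g - g') (w - w') := by
  obtain ⟨u1, u2, u3, p1, p2, p3, h1, h2, h3, e1, e2, e3, e4⟩ := h
  obtain ⟨u1', u2', u3', p1', p2', p3', h1', h2', h3', e1', e2', e3', e4'⟩ := h'
  refine ⟨u1 - u1', u2 - u2', u3 - u3', p1 - p1', p2 - p2', p3 - p3', ?_, ?_, ?_, ?_, ?_, ?_, ?_⟩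
  · rw [map_sub, ← h1, ← h1']; ring
  · rw [map_sub, ← h2, ← h2']; ring
  · rw [map_sub, ← h3, ← h3']; ring
  · rw [map_sub, ← e1, ← e1']; module
  · rw [map_sub, ← e2, ← e2']; module
  · rw [map_sub, ← e3, ← e3']; module
  · rw [sub_smul, ← e4, ← e4']; module

lemma Dat.mem {A B C g w : S} (hR : LinearMap.range R = ARmod f) (hk : R ρ = 0) (hr : Reg3 A B C) (h : Dat f R ρ A B C g w)
    (hw : ∃ a b c, w = A * a + B * b + C * c) : g ∈ Jf f := by
  obtain ⟨u1, u2, u3, p1, p2, p3, h1, h2, h3, e1, e2, e3, e4⟩ := h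
  obtain ⟨a, b, c, rfl⟩ := hw
  have : C • (p1 - c • ρ) - B • (p2 + b • ρ) + A • (p3 - a • ρ) = 0 := by
    have : C • (p1 - c • ρ) - B • (p2 + b • ρ) + A • (p3 - a • ρ) =
      (C • p1 - B • p2 + A • p3) - (A * a + B * b + C * c) • ρ := by module
    rw [this, e4, sub_self]
  obtain ⟨t1, t2, t3, q1, q2, q3⟩ := hr.koszulv this
  have r1 : R p1 = B • R t1 - A • R t2 := by
    have := congrArg R q1
    simpa [hk] using this
  have : B • (u1 - R t1) = A • (u2 - R t2) := by
    rw [r1] at e1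
    rw [smul_sub, smul_sub, sub_eq_sub_iff_sub_eq_sub]
    exact e1
  obtain ⟨u, hu, -⟩ := hr.k2v this
  rw [mem_Jf_iff]
  refine ⟨u, mul_left_cancel₀ hr.a0 ?_⟩
  have ht : eqnMap f (R t1) = 0 := by
    have : R t1 ∈ ARmod f := hR ▸ LinearMap.mem_range_self R t1
    exact this
  rw [h1, ← smul_eq_mul, ← map_smul, ← hu, map_sub, ht, sub_zero]

lemma Dat.rho {A B C g w : S} (h : Dat f R ρ A B C g w) (i : ι) :
    ∃ a b c, w * ρ i = A * a + B * b + C * c := by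
  obtain ⟨u1, u2, u3, p1, p2, p3, h1, h2, h3, e1, e2, e3, e4⟩ := h
  refine ⟨p3 i, - p2 i, p1 i, ?_⟩
  have := congrFun e4 i
  simp at this
  rw [← this]; ring

end Dat

lemma hc_mul {m : ℕ} {a : S} (ha : a ∈ Sgr m) (n : ℕ) (b : S) :
    homogeneousComponent (m + n) (a * b) = a * homogeneousComponent n b := by
  let _ : GradedRing (homogeneousSubmodule (Fin 3) ℂ) := MvPolynomial.gradedAlgebra
  have := DirectSum.coe_decompose_mul_add_of_left_mem (homogeneousSubmodule (Fin 3) ℂ)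
    (i := m) (j := n) (a := a) (b := b) ha
  have e := fun (φ : S) (i : ℕ) => decomposition.decompose'_apply (σ := Fin 3) (R := ℂ) φ i
  erw [e, e] at this
  exact this

lemma hc_mul_lt {m : ℕ} {a : S} (ha : a ∈ Sgr m) {n : ℕ} (hn : n < m) (b : S) :
    homogeneousComponent n (a * b) = 0 := by
  let _ : GradedRing (homogeneousSubmodule (Fin 3) ℂ) := MvPolynomial.gradedAlgebra
  have := DirectSum.coe_decompose_mul_of_left_mem_of_not_le (homogeneousSubmodule (Fin 3) ℂ)
    (i := m) (n := n) (a := a) (b := b) ha (by omega)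
  have e := fun (φ : S) (i : ℕ) => decomposition.decompose'_apply (σ := Fin 3) (R := ℂ) φ i
  erw [e] at this
  exact this

lemma hc_self {m : ℕ} {a : S} (ha : a ∈ Sgr m) : homogeneousComponent m a = a :=
  homogeneousComponent_eq_self ha

lemma hc_mem (m : ℕ) (a : S) : homogeneousComponent m a ∈ Sgr m :=
  homogeneousComponent_mem m a

lemma Sgr_mul {m n : ℕ} {a b : S} (ha : a ∈ Sgr m) (hb : b ∈ Sgr n) : a * b ∈ Sgr (m + n) :=
  IsHomogeneous.mul ha hb

lemma Sgr_quot {m n : ℕ} {a h : S} (ha : a ∈ Sgr n) (h0 : a ≠ 0) (hh : a * h ∈ Sgr (n + m)) :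
    h ∈ Sgr m := by
  have := hc_mul ha m h
  rw [hc_self hh] at this
  rw [mul_left_cancel₀ h0 this]
  exact hc_mem _ _

/-- Primitive vectors. -/
def Prim (v : Fin 3 → S) : Prop := ∀ c, (∀ i, c ∣ v i) → IsUnit c

lemma Prim.ne {v : Fin 3 → S} (h : Prim v) : ∃ j, v j ≠ 0 := by
  by_contra hc
  push Not at hc
  exact not_isUnit_zero (h 0 (fun i => by rw [hc i]))

lemma Prim.smul_of {v m : Fin 3 → S} (h : Prim v) (e : ∀ i j, m i * v j = m j * v i) :
    ∃ c : S, m = c • v := by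
  obtain ⟨j, hj⟩ := h.ne
  have hd : v j ∣ m j := by
    let _ := UniqueFactorizationMonoid.toGCDMonoid S
    have h1 : v j ∣ m j * gcd (v 0) (gcd (v 1) (v 2)) := by
      have a : ∀ i, v j ∣ m j * v i := fun i => ⟨m i, by rw [← e]; ring⟩
      refine (dvd_gcd (a 0) ((dvd_gcd (a 1) (a 2)).trans (gcd_mul_left' _ _ _).dvd)).trans
        (gcd_mul_left' _ _ _).dvd
    have hu : IsUnit (gcd (v 0) (gcd (v 1) (v 2))) := by
      apply h
      intro i
      fin_cases i
      · exact gcd_dvd_left _ _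
      · exact (gcd_dvd_right _ _).trans (gcd_dvd_left _ _)
      · exact (gcd_dvd_right _ _).trans (gcd_dvd_right _ _)
    exact (hu.dvd_mul_right).1 h1
  obtain ⟨c, hc⟩ := hd
  refine ⟨c, funext fun i => mul_left_cancel₀ hj ?_⟩
  have := e i j
  rw [hc] at this
  change v j * m i = v j * (c * v i)
  linear_combination this

/-- Gradient. -/
def grad (f : S) : Fin 3 → S := fun i => pderiv i f

lemma eqnMap_apply (f : S) (u : Fin 3 → S) :
    eqnMap f u = u 0 * grad f 0 + u 1 * grad f 1 + u 2 * grad f 2 := by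
  simp [eqnMap, Fin.sum_univ_three, grad]

lemma pderiv_deg {p : S} {i : Fin 3} (h : pderiv i p ≠ 0) :
    (pderiv i p).totalDegree < p.totalDegree := by
  have hlt : ∀ m ∈ (pderiv i p).support, m.degree + 1 ≤ p.totalDegree := by
    intro m hm
    rw [mem_support_iff, coeff_pderiv] at hm
    have : m + Finsupp.single i 1 ∈ p.support := by
      rw [mem_support_iff]
      intro h0
      apply hm
      rw [h0]; simp
    have := le_totalDegree this
    have h2 : ((m + Finsupp.single i 1).sum fun _ e => e) = m.degree + 1 := by
      have : ((m + Finsupp.single i 1).sum fun _ e => e) = (m + Finsupp.single i 1).degree := rfl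
      rw [this, map_add]
      simp
    omega
  obtain ⟨m0, hm0⟩ := support_nonempty.2 h
  have h0 := hlt m0 hm0
  have : (pderiv i p).totalDegree ≤ p.totalDegree - 1 := by
    rw [totalDegree]
    apply Finset.sup_le
    intro m hm
    have : (m.sum fun _ e => e) = m.degree := rfl
    have := hlt m hm
    omega
  omega

lemma eq_C_of_pderiv {p : S} (h : ∀ i, pderiv i p = 0) : p.totalDegree = 0 := by
  rw [totalDegree_eq_zero_iff]
  intro m hm i
  by_contra hi
  have := congrArg (coeff (m - Finsupp.single i 1)) (h i)
  rw [coeff_pderiv] at this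
  have e : m - Finsupp.single i 1 + Finsupp.single i 1 = m := by
    ext j
    by_cases hj : i = j
    · subst hj; simp; omega
    · simp [hj]
  rw [e] at this
  simp only [coeff_zero, mul_eq_zero] at this
  rcases this with h1 | h1
  · exact (mem_support_iff.1 hm) h1
  · norm_cast at h1

lemma grad_mem {f : S} {d : ℕ} (hf : f.IsHomogeneous d) (i : Fin 3) : grad f i ∈ Sgr (d - 1) :=
  hf.pderiv

lemma grad_prim {f : S} {d : ℕ} (hf : f.IsHomogeneous d) (hd : 1 ≤ d) (hs : Squarefree f) :
    Prim (grad f) := by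
  have hdiv : ∀ c, (∀ i, c ∣ grad f i) → c ∣ f := by
    intro c hc
    have := hf.sum_X_mul_pderiv
    have h1 : c ∣ (d : S) * f := by
      rw [← nsmul_eq_mul, ← this]
      exact Finset.dvd_sum fun i _ => (hc i).mul_left _
    have hu : IsUnit (d : S) := by
      have : (d : S) = C (d : ℂ) := by simp
      rw [this]
      exact (IsUnit.mk0 (d : ℂ) (by exact_mod_cast (by omega : d ≠ 0))).map C
    exact (hu.dvd_mul_left).1 h1
  intro c hc
  by_contra hcu
  have hf0 : f ≠ 0 := hs.ne_zero
  have hc0 : c ≠ 0 := by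
    rintro rfl
    exact hf0 (zero_dvd_iff.1 (hdiv 0 hc))
  obtain ⟨p, hp, hpc⟩ := WfDvdMonoid.exists_irreducible_factor hcu hc0
  have hpp : Prime p := hp.prime
  have hpi : ∀ i, p ∣ grad f i := fun i => hpc.trans (hc i)
  obtain ⟨g, rfl⟩ := hdiv p hpi
  by_cases hg : p ∣ g
  · exact hp.not_isUnit (hs p (mul_dvd_mul_left p hg))
  have h0 : ∀ i, pderiv i p = 0 := by
    intro i
    have h1 : p ∣ pderiv i p * g := by
      have := hpi i
      simp only [grad, pderiv_mul] at this
      exact (dvd_add_left (dvd_mul_right p _)).1 this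
    by_contra hne
    obtain ⟨e, he⟩ := (hpp.dvd_or_dvd h1).resolve_right hg
    have hlt := pderiv_deg hne
    have he0 : e ≠ 0 := by rintro rfl; simp at he; exact hne he
    rw [he, totalDegree_mul_of_isDomain hp.ne_zero he0] at hlt
    omega
  have := eq_C_of_pderiv h0
  rw [totalDegree_eq_zero_iff_eq_C] at this
  apply hp.not_isUnit
  rw [this]
  refine (IsUnit.mk0 _ ?_).map C
  intro h
  rw [h] at this
  exact hp.ne_zero (by simpa using this)

lemma AR_hc {f : S} {d : ℕ} (hf : f.IsHomogeneous d) {u : Fin 3 → S} (hu : u ∈ ARmod f) (n : ℕ) :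
    (fun i => homogeneousComponent n (u i)) ∈ ARmod f := by
  have h0 : eqnMap f u = 0 := hu
  change eqnMap f _ = 0
  rw [eqnMap_apply] at h0 ⊢
  have := congrArg (homogeneousComponent (d - 1 + n)) h0
  rw [map_add, map_add, mul_comm (u 0), mul_comm (u 1), mul_comm (u 2),
    hc_mul (grad_mem hf _), hc_mul (grad_mem hf _), hc_mul (grad_mem hf _), map_zero] at this
  linear_combination this

lemma AR_of_smul {f : S} {c : S} (hc : c ≠ 0) {u : Fin 3 → S} (h : c • u ∈ ARmod f) :
    u ∈ ARmod f := by
  have h0 : eqnMap f (c • u) = 0 := h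
  rw [map_smul, smul_eq_mul] at h0
  exact (mul_eq_zero.1 h0).resolve_left hc

lemma exists_hc_ne {u : Fin 3 → S} (hu : u ≠ 0) :
    ∃ n, (fun i => homogeneousComponent n (u i)) ≠ 0 := by
  by_contra hc
  push Not at hc
  apply hu
  funext i
  rw [← sum_homogeneousComponent (u i)]
  apply Finset.sum_eq_zero
  intro n _
  exact congrFun (hc n) i

lemma r_prim {f : S} {d d1 : ℕ} (hf : f.IsHomogeneous d) (hd1 : IsLeast (mdrSet f) d1)
    {r : Fin 3 → S} (hr : r ∈ ARmod f) (hr0 : r ≠ 0) (hrh : IsHomRel r d1) : Prim r := by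
  intro c hc
  choose r' hr' using hc
  have hre : r = c • r' := funext hr'
  have hc0 : c ≠ 0 := by rintro rfl; simp at hre; exact hr0 hre
  have hr'0 : r' ≠ 0 := by rintro rfl; simp at hre; exact hr0 hre
  have hA : r' ∈ ARmod f := AR_of_smul hc0 (hre ▸ hr)
  obtain ⟨n, hn⟩ := exists_hc_ne hr'0
  have hle : d1 ≤ n := hd1.2 ⟨_, AR_hc hf hA n, hn, fun i => hc_mem n _⟩
  obtain ⟨i, hi⟩ := Function.ne_iff.1 hn
  have h1 : n ≤ (r' i).totalDegree := by
    by_contra hlt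
    exact hi (homogeneousComponent_eq_zero _ _ (by omega))
  have hri0 : r' i ≠ 0 := by intro h; simp [h] at hi
  have h2 : (r i).totalDegree ≤ d1 := IsHomogeneous.totalDegree_le (hrh i)
  rw [hr' i, totalDegree_mul_of_isDomain hc0 hri0] at h2
  have h3 : c.totalDegree = 0 := by omega
  rw [totalDegree_eq_zero_iff_eq_C] at h3
  rw [h3]
  refine (IsUnit.mk0 _ ?_).map C
  intro h
  rw [h] at h3
  exact hc0 (by simpa using h3)

lemma phi_exists {f : S} (hg : Prim (grad f)) {r s : Fin 3 → S} (hr : r ∈ ARmod f)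
    (hs : s ∈ ARmod f) : ∃ h : S, crossProduct r s = h • grad f := by
  have h1 : eqnMap f r = 0 := hr
  have h2 : eqnMap f s = 0 := hs
  rw [eqnMap_apply] at h1 h2
  apply hg.smul_of
  intro i j
  fin_cases i <;> fin_cases j <;> simp [cross_apply]
  · linear_combination s 2 * h1 - r 2 * h2
  · linear_combination r 1 * h2 - s 1 * h1
  · linear_combination r 2 * h2 - s 2 * h1
  · linear_combination s 0 * h1 - r 0 * h2
  · linear_combination s 1 * h1 - r 1 * h2
  · linear_combination r 0 * h2 - s 0 * h1

lemma phi_ker {r s : Fin 3 → S} (hr : Prim r) (h : crossProduct r s = 0) : ∃ p : S, s = p • r := by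
  apply hr.smul_of
  rw [cross_apply] at h
  have h0 := congrFun h 0
  have h1 := congrFun h 1
  have h2 := congrFun h 2
  simp at h0 h1 h2
  intro i j
  fin_cases i <;> fin_cases j <;> simp
  · linear_combination -h2
  · linear_combination h1
  · linear_combination h2
  · linear_combination -h0
  · linear_combination -h1
  · linear_combination h0

/-- Coordinates adapted to a point. -/
structure Pencil (l1 l2 l3 : S) (π : S →ₐ[ℂ] Polynomial ℂ) : Prop where
  h1 : l1 ∈ Sgr 1
  h2 : l2 ∈ Sgr 1
  h3 : l3 ∈ Sgr 1
  n1 : l1 ≠ 0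
  n2 : l2 ≠ 0
  rp : IsRelPrime l1 l2
  p1 : π l1 = 0
  p2 : π l2 = 0
  p3 : π l3 = Polynomial.X
  ker : ∀ w, π w = 0 → ∃ a b, w = l1 * a + l2 * b
  hom : ∀ m, ∀ w ∈ Sgr m, ∃ c : ℂ, π w = Polynomial.C c * Polynomial.X ^ m

lemma Pencil.reg {l1 l2 l3 : S} {π : S →ₐ[ℂ] Polynomial ℂ} (h : Pencil l1 l2 l3 π) {c : S}
    (hc : π c ≠ 0) : Reg3 l1 l2 c := by
  refine ⟨h.n1, h.n2, h.rp, ?_⟩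
  intro x a b e
  apply h.ker
  have := congrArg π e
  simp only [map_mul, map_add, h.p1, h.p2, zero_mul, add_zero] at this
  exact (mul_eq_zero.1 this).resolve_left hc

lemma linform {l : S} (h : l ∈ Sgr 1) :
    ∃ a : Fin 3 → ℂ, l = C (a 0) * X 0 + C (a 1) * X 1 + C (a 2) * X 2 := by
  unfold Sgr at h
  rw [homogeneousSubmodule_one_eq_span_X, Submodule.mem_span_range_iff_exists_fun] at h
  obtain ⟨c, hc⟩ := h
  refine ⟨c, ?_⟩
  rw [← hc, Fin.sum_univ_three]
  simp [smul_eq_C_mul]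

lemma linform_mem (a : Fin 3 → ℂ) : C (a 0) * X 0 + C (a 1) * X 1 + C (a 2) * X 2 ∈ Sgr 1 := by
  refine Submodule.add_mem _ (Submodule.add_mem _ ?_ ?_) ?_ <;>
  exact isHomogeneous_C_mul_X _ _

lemma exists_pencil {l1 l2 : S} (h1 : l1 ∈ Sgr 1) (h2 : l2 ∈ Sgr 1)
    (hi : ∀ α β : ℂ, C α * l1 + C β * l2 = 0 → α = 0 ∧ β = 0) :
    ∃ l3 π, Pencil l1 l2 l3 π := by
  obtain ⟨a, ha⟩ := linform h1
  obtain ⟨b, hb⟩ := linform h2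
  have n1 : l1 ≠ 0 := by
    intro h
    have := hi 1 0 (by rw [h]; simp)
    simp at this
  have n2 : l2 ≠ 0 := by
    intro h
    have := hi 0 1 (by rw [h]; simp)
    simp at this
  have hq : crossProduct a b ≠ 0 := by
    rw [crossProduct_ne_zero_iff_linearIndependent, LinearIndependent.pair_iff]
    intro s t hst
    apply hi
    have e0 := congrFun hst 0
    have e1 := congrFun hst 1
    have e2 := congrFun hst 2
    simp at e0 e1 e2
    have e0 := congrArg (C : ℂ → S) e0
    have e1 := congrArg (C : ℂ → S) e1
    have e2 := congrArg (C : ℂ → S) e2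
    simp only [map_add, map_mul, map_zero] at e0 e1 e2
    rw [ha, hb]
    linear_combination X 0 * e0 + X 1 * e1 + X 2 * e2
  obtain ⟨e, he⟩ : ∃ e : Fin 3 → ℂ, e 0 * (a 1 * b 2 - a 2 * b 1) + e 1 * (a 2 * b 0 - a 0 * b 2)
      + e 2 * (a 0 * b 1 - a 1 * b 0) = 1 := by
    obtain ⟨i, hi⟩ := Function.ne_iff.1 hq
    rw [cross_apply] at hi
    fin_cases i <;> simp at hi
    · exact ⟨![(a 1 * b 2 - a 2 * b 1)⁻¹, 0, 0], by simp [inv_mul_cancel₀ hi]⟩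
    · exact ⟨![0, (a 2 * b 0 - a 0 * b 2)⁻¹, 0], by simp [inv_mul_cancel₀ hi]⟩
    · exact ⟨![0, 0, (a 0 * b 1 - a 1 * b 0)⁻¹], by simp [inv_mul_cancel₀ hi]⟩
  set l3 : S := C (e 0) * X 0 + C (e 1) * X 1 + C (e 2) * X 2 with hl3
  let q : Fin 3 → ℂ := ![a 1 * b 2 - a 2 * b 1, a 2 * b 0 - a 0 * b 2, a 0 * b 1 - a 1 * b 0]
  let π : S →ₐ[ℂ] Polynomial ℂ := aeval (fun i => Polynomial.C (q i) * Polynomial.X)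
  have hπX : ∀ i, π (X i) = Polynomial.C (q i) * Polynomial.X := fun i => by simp [π]
  have hπC : ∀ c, π (C c) = Polynomial.C c := fun c => by
    rw [← algebraMap_eq, AlgHom.commutes]; rfl
  have hform : ∀ c : Fin 3 → ℂ, π (C (c 0) * X 0 + C (c 1) * X 1 + C (c 2) * X 2) =
      Polynomial.C (c 0 * q 0 + c 1 * q 1 + c 2 * q 2) * Polynomial.X := by
    intro c
    simp only [map_add, map_mul, hπX, hπC]
    ring
  have he' := congrArg (C : ℂ → S) he
  simp only [map_add, map_sub, map_mul, map_one] at he'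
  have hX : ∀ i, X i - C (q i) * l3 ∈ Ideal.span {l1, l2} := by
    intro i
    rw [Ideal.mem_span_pair, ha, hb, hl3]
    fin_cases i
    · refine ⟨C (b 1 * e 2 - b 2 * e 1), C (e 1 * a 2 - e 2 * a 1), ?_⟩
      simp [q]
      linear_combination X 0 * he'
    · refine ⟨C (b 2 * e 0 - b 0 * e 2), C (e 2 * a 0 - e 0 * a 2), ?_⟩
      simp [q]
      linear_combination X 1 * he'
    · refine ⟨C (b 0 * e 1 - b 1 * e 0), C (e 0 * a 1 - e 1 * a 0), ?_⟩
      simp [q]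
      linear_combination X 2 * he'
  refine ⟨l3, π, ⟨h1, h2, linform_mem e, n1, n2, ?_, ?_, ?_, ?_, ?_, ?_⟩⟩
  · rintro c ⟨m1, hm1⟩ ⟨m2, hm2⟩
    have c0 : c ≠ 0 := by rintro rfl; simp at hm1; exact n1 hm1
    have m10 : m1 ≠ 0 := by rintro rfl; simp at hm1; exact n1 hm1
    have m20 : m2 ≠ 0 := by rintro rfl; simp at hm2; exact n2 hm2
    have t1 : l1.totalDegree = 1 := IsHomogeneous.totalDegree h1 n1
    have t2 : l2.totalDegree = 1 := IsHomogeneous.totalDegree h2 n2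
    rw [hm1, totalDegree_mul_of_isDomain c0 m10] at t1
    rw [hm2, totalDegree_mul_of_isDomain c0 m20] at t2
    by_cases hc : c.totalDegree = 0
    · rw [totalDegree_eq_zero_iff_eq_C] at hc
      rw [hc]
      refine (IsUnit.mk0 _ ?_).map C
      intro h
      rw [h] at hc
      exact c0 (by simpa using hc)
    · exfalso
      have z1 : m1.totalDegree = 0 := by omega
      have z2 : m2.totalDegree = 0 := by omega
      rw [totalDegree_eq_zero_iff_eq_C] at z1 z2
      have := hi (coeff 0 m2) (-coeff 0 m1) (by
        rw [map_neg, ← z1, ← z2, hm1, hm2]; ring)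
      rw [this.1] at z2
      exact m20 (by simpa using z2)
  · rw [ha, hform]
    have : a 0 * q 0 + a 1 * q 1 + a 2 * q 2 = 0 := by simp [q]; ring
    rw [this]; simp
  · rw [hb, hform]
    have : b 0 * q 0 + b 1 * q 1 + b 2 * q 2 = 0 := by simp [q]; ring
    rw [this]; simp
  · rw [hl3, hform]
    have : e 0 * q 0 + e 1 * q 1 + e 2 * q 2 = 1 := by simp [q]; linear_combination he
    rw [this]; simp
  · intro w hw
    let I : Ideal S := Ideal.span {l1, l2}
    have hh : (Ideal.Quotient.mkₐ ℂ I) = ((Ideal.Quotient.mkₐ ℂ I).comp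
        ((Polynomial.aeval l3).comp π)) := by
      apply algHom_ext
      intro i
      simp only [AlgHom.comp_apply, hπX, map_mul, Polynomial.aeval_X, Polynomial.aeval_C]
      rw [← map_mul, Ideal.Quotient.mkₐ_eq_mk, Ideal.Quotient.mk_eq_mk_iff_sub_mem]
      exact hX i
    have := congrArg (fun φ => φ w) hh
    simp only [AlgHom.comp_apply, hw, map_zero] at this
    rw [Ideal.Quotient.mkₐ_eq_mk, Ideal.Quotient.eq_zero_iff_mem, Ideal.mem_span_pair] at this
    obtain ⟨x, y, hxy⟩ := this
    exact ⟨x, y, by rw [← hxy]; ring⟩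
  · intro m w hw
    have hw : w.IsHomogeneous m := hw
    refine ⟨∑ s ∈ w.support, coeff s w * ∏ i, q i ^ s i, ?_⟩
    conv_lhs => rw [w.as_sum]
    rw [map_sum, map_sum, Finset.sum_mul]
    apply Finset.sum_congr rfl
    intro s hs
    rw [monomial_eq, map_mul, hπC, Finsupp.prod_fintype _ _ (by simp), map_prod]
    simp only [map_pow, hπX, mul_pow, Finset.prod_mul_distrib, map_mul, map_prod]
    rw [Finset.prod_pow_eq_pow_sum]
    have : ∑ i, s i = m := by
      rw [hw.degree_eq_sum_deg_support hs]
      exact (Finsupp.sum_fintype s (fun _ e => e) (fun _ => rfl)).symm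
    rw [this]
    ring

lemma mem_Isat (f g : S) : g ∈ Isat f ↔ ∃ n : ℕ, ∀ w ∈ mId ^ n, w * g ∈ Jf f := by
  unfold Isat
  have hmono : Monotone fun n : ℕ => Submodule.colon (Jf f) ((mId ^ n : Ideal S) : Submodule S S) := by
    intro a b hab x hx
    rw [Submodule.mem_colon] at hx ⊢
    intro p hp
    exact hx p (Ideal.pow_le_pow_right hab hp)
  rw [Submodule.mem_iSup_of_directed _ hmono.directed_le]
  refine exists_congr fun n => ?_
  rw [Submodule.mem_colon]
  refine forall_congr' fun w => imp_congr Iff.rfl ?_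
  rw [smul_eq_mul, mul_comm]

lemma Sgr1_mId {l : S} (h : l ∈ Sgr 1) : l ∈ mId := by
  obtain ⟨a, rfl⟩ := linform h
  have hX : ∀ i : Fin 3, (X i : S) ∈ mId := by
    intro i
    apply Ideal.subset_span
    fin_cases i <;> simp
  exact Ideal.add_mem _ (Ideal.add_mem _ (Ideal.mul_mem_left _ _ (hX 0))
    (Ideal.mul_mem_left _ _ (hX 1))) (Ideal.mul_mem_left _ _ (hX 2))

lemma Jf_hc {f : S} {d : ℕ} (hf : f.IsHomogeneous d) {g : S} (hg : g ∈ Jf f) (k : ℕ) :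
    homogeneousComponent k g ∈ Jf f := by
  rw [mem_Jf_iff] at hg
  obtain ⟨u, rfl⟩ := hg
  rw [eqnMap_apply, map_add, map_add, mul_comm (u 0), mul_comm (u 1), mul_comm (u 2)]
  have hgJ : ∀ i : Fin 3, grad f i ∈ Jf f := by
    intro i
    apply Ideal.subset_span
    fin_cases i <;> simp [grad]
  have : ∀ i, homogeneousComponent k (grad f i * u i) ∈ Jf f := by
    intro i
    by_cases hk : k < d - 1
    · rw [hc_mul_lt (grad_mem hf i) hk]; exact zero_mem _
    · obtain ⟨m, rfl⟩ := Nat.exists_eq_add_of_le (not_lt.1 hk)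
      rw [hc_mul (grad_mem hf i)]
      exact Ideal.mul_mem_right _ _ (hgJ i)
  exact Ideal.add_mem _ (Ideal.add_mem _ (this 0) (this 1)) (this 2)

/-- `s` has invariant `h` with respect to `r`. -/
def Ph (f : S) (r s : Fin 3 → S) (h : S) : Prop := crossProduct r s = h • grad f

lemma Ph.add {f : S} {r s s' : Fin 3 → S} {h h' : S} (e : Ph f r s h) (e' : Ph f r s' h') :
    Ph f r (s + s') (h + h') := by
  unfold Ph at *
  rw [map_add, e, e', add_smul]

lemma Ph.sub {f : S} {r s s' : Fin 3 → S} {h h' : S} (e : Ph f r s h) (e' : Ph f r s' h') :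
    Ph f r (s - s') (h - h') := by
  unfold Ph at *
  rw [map_sub, e, e', sub_smul]

lemma Ph.smul {f : S} {r s : Fin 3 → S} {h : S} (e : Ph f r s h) (q : S) :
    Ph f r (q • s) (q * h) := by
  unfold Ph at *
  rw [map_smul, e, mul_smul]

lemma Ph.self (f : S) (r : Fin 3 → S) : Ph f r r 0 := by
  unfold Ph
  rw [cross_self, zero_smul]

lemma Ph.ker {f : S} {r s : Fin 3 → S} (hr : Prim r) (e : Ph f r s 0) : ∃ p : S, s = p • r := by
  unfold Ph at e
  rw [zero_smul] at e
  exact phi_ker hr e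

lemma Prim.smul_eq {v : Fin 3 → S} (h : Prim v) {a b : S} (e : a • v = b • v) : a = b := by
  obtain ⟨j, hj⟩ := h.ne
  exact mul_right_cancel₀ hj (congrFun e j)

lemma Ph.uniq {f : S} (hg : Prim (grad f)) {r s : Fin 3 → S} {h h' : S} (e : Ph f r s h)
    (e' : Ph f r s h') : h = h' :=
  hg.smul_eq (e.symm.trans e')

lemma free_case {f : S} (hg : Prim (grad f)) {r s : Fin 3 → S} (hr : r ∈ ARmod f) (hrp : Prim r)
    (hs : s ∈ ARmod f) (h1 : Ph f r s 1) {l1 l2 l3 : S} {π : S →ₐ[ℂ] Polynomial ℂ}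
    (hP : Pencil l1 l2 l3 π) {g : S} (hgI : g ∈ Isat f) : g ∈ Jf f := by
  obtain ⟨n, hn⟩ := (mem_Isat f g).1 hgI
  let R : (Fin 2 → S) →ₗ[S] (Fin 3 → S) := Fintype.linearCombination S ![r, s]
  have hRa : ∀ p, R p = p 0 • r + p 1 • s := by
    intro p
    simp [R, Fintype.linearCombination_apply, Fin.sum_univ_two]
  have hR : LinearMap.range R = ARmod f := by
    apply le_antisymm
    · rintro _ ⟨p, rfl⟩
      rw [hRa]
      exact Submodule.add_mem _ (Submodule.smul_mem _ _ hr) (Submodule.smul_mem _ _ hs)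
    · intro t ht
      obtain ⟨h, hh⟩ := phi_exists hg hr ht
      have hh : Ph f r t h := hh
      have : Ph f r (t - h • s) 0 := by
        have := hh.sub (h1.smul h)
        rwa [mul_one, sub_self] at this
      obtain ⟨p, hp⟩ := this.ker hrp
      refine ⟨![p, h], ?_⟩
      rw [hRa]
      simp [← hp]
  have hk : LinearMap.ker R = Submodule.span S {(0 : Fin 2 → S)} := by
    rw [Submodule.span_zero_singleton, LinearMap.ker_eq_bot']
    intro p hp
    rw [hRa] at hp
    have e := ((Ph.self f r).smul (p 0)).add (h1.smul (p 1))
    rw [hp] at e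
    have e0 : Ph f r 0 0 := by unfold Ph; simp
    have hp1 := e.uniq hg e0
    simp at hp1
    rw [hp1, zero_smul, add_zero] at hp
    have hp0 : p 0 = 0 := hrp.smul_eq (by rw [hp, zero_smul])
    funext i
    fin_cases i
    · exact hp0
    · exact hp1
  have hl : ∀ l ∈ Sgr 1, l ^ n * g ∈ Jf f := fun l hl => hn _ (Ideal.pow_mem_pow (Sgr1_mId hl) n)
  obtain ⟨w, hw⟩ := Dat.exists hR hk (hl l1 hP.h1) (hl l2 hP.h2) (hl l3 hP.h3)
  have hw0 : Dat f R 0 (l1 ^ n) (l2 ^ n) (l3 ^ n) g 0 := by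
    obtain ⟨u1, u2, u3, p1, p2, p3, a1, a2, a3, e1, e2, e3, e4⟩ := hw
    exact ⟨u1, u2, u3, p1, p2, p3, a1, a2, a3, e1, e2, e3, by rw [e4]; simp⟩
  refine hw0.mem hR (map_zero R) (Reg3.pow (hP.reg ?_) n n) ⟨0, 0, 0, by simp⟩
  rw [map_pow, hP.p3]
  exact pow_ne_zero _ Polynomial.X_ne_zero

lemma sat0 {f : S} {r s1 s2 : Fin 3 → S} (h1 : s1 ∈ ARmod f)
    (hr : r ∈ ARmod f) {l1 l2 l3 : S} {π : S →ₐ[ℂ] Polynomial ℂ}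
    (hP : Pencil l1 l2 l3 π) (e1 : Ph f r s1 l1) {t1 t2 : S}
    (e : l2 • s1 - l1 • s2 = (l2 * t1 - l1 * t2) • r) : ∃ s ∈ ARmod f, Ph f r s 1 := by
  have hreg : Reg3 l1 l2 l3 := hP.reg (by rw [hP.p3]; exact Polynomial.X_ne_zero)
  have : l2 • (s1 - t1 • r) = l1 • (s2 - t2 • r) := by
    rw [← sub_eq_zero] at e ⊢
    rw [← e]; module
  obtain ⟨s, hs, -⟩ := hreg.k2v this
  refine ⟨s, AR_of_smul hP.n1 ?_, ?_⟩
  · rw [← hs]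
    exact Submodule.sub_mem _ h1 (Submodule.smul_mem _ _ hr)
  · have h2 := e1.sub ((Ph.self f r).smul t1)
    rw [hs] at h2
    unfold Ph at h2 ⊢
    rw [map_smul, mul_zero, sub_zero] at h2
    rw [one_smul]
    exact smul_right_injective _ hP.n1 h2

lemma sat1 {f : S} {r s1 s2 s3 : Fin 3 → S} (h1 : s1 ∈ ARmod f)
    (hr : r ∈ ARmod f) (hrp : Prim r) {l1 l2 l3 : S} {π : S →ₐ[ℂ] Polynomial ℂ}
    (hP : Pencil l1 l2 l3 π) (e1 : Ph f r s1 l1) (e2 : Ph f r s2 l2) {c : S} (e3 : Ph f r s3 c)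
    (hc : π c ≠ 0) : ∃ s ∈ ARmod f, Ph f r s 1 := by
  have hreg : Reg3 l1 l2 c := hP.reg hc
  have key : ∀ {a b : S} {s t : Fin 3 → S}, Ph f r s a → Ph f r t b →
      ∃ p : S, b • s - a • t = p • r := by
    intro a b s t hs ht
    refine Ph.ker (f := f) hrp ?_
    have := (hs.smul b).sub (ht.smul a)
    rwa [mul_comm b a, sub_self] at this
  obtain ⟨w1, q1⟩ := key e1 e2
  obtain ⟨w2, q2⟩ := key e1 e3
  obtain ⟨w3, q3⟩ := key e2 e3
  have : c * w1 - l2 * w2 + l1 * w3 = 0 := by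
    apply hrp.smul_eq
    rw [add_smul, sub_smul, mul_smul, mul_smul, mul_smul, ← q1, ← q2, ← q3]
    module
  obtain ⟨t1, t2, t3, z1, -, -⟩ := hreg.koszul this
  rw [z1] at q1
  exact sat0 h1 hr hP e1 q1

lemma Sgr_C_mul {m : ℕ} {a : S} (c : ℂ) (ha : a ∈ Sgr m) : C c * a ∈ Sgr m := by
  rw [C_mul']
  exact Submodule.smul_mem _ _ ha

lemma Sgr_pow {l : S} (h : l ∈ Sgr 1) (n : ℕ) : l ^ n ∈ Sgr n := by
  have := IsHomogeneous.pow (show l.IsHomogeneous 1 from h) n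
  rwa [one_mul] at this

lemma norm_rel {f : S} {d1 e : ℕ} (hg : Prim (grad f)) {r s1 s2 : Fin 3 → S}
    (hr : r ∈ ARmod f) (hrp : Prim r) (hrh : IsHomRel r d1)
    (h1 : s1 ∈ ARmod f) (h2 : s2 ∈ ARmod f) (h1h : IsHomRel s1 (d1 + e))
    (h2h : IsHomRel s2 (d1 + e))
    {l1 l2 l3 : S} {π : S →ₐ[ℂ] Polynomial ℂ} (hP : Pencil l1 l2 l3 π)
    (e1 : Ph f r s1 l1) (e2 : Ph f r s2 l2) (hN : ∃ g ∈ Isat f, g ∉ Jf f) :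
    ∃ c : ℂ, c ≠ 0 ∧ ∃ s1' s2' : Fin 3 → S, s1' ∈ ARmod f ∧ s2' ∈ ARmod f ∧
      IsHomRel s1' (d1 + e) ∧ IsHomRel s2' (d1 + e) ∧ Ph f r s1' l1 ∧ Ph f r s2' l2 ∧
      l2 • s1' - l1 • s2' = (C c * l3 ^ (1 + e)) • r := by
  obtain ⟨v, hv⟩ : ∃ v : S, l2 • s1 - l1 • s2 = v • r := by
    refine Ph.ker (f := f) hrp ?_
    have := (e1.smul l2).sub (e2.smul l1)
    rwa [mul_comm l2 l1, sub_self] at this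
  have hvh : v ∈ Sgr (1 + e) := by
    obtain ⟨j, hj⟩ := hrp.ne
    refine Sgr_quot (hrh j) hj ?_
    have := congrFun hv j
    simp only [Pi.sub_apply, Pi.smul_apply, smul_eq_mul] at this
    rw [mul_comm, ← this, show d1 + (1 + e) = 1 + (d1 + e) by ring]
    exact Submodule.sub_mem _ (Sgr_mul hP.h2 (h1h j)) (Sgr_mul hP.h1 (h2h j))
  obtain ⟨c, hc⟩ := hP.hom _ _ hvh
  have hc0 : c ≠ 0 := by
    rintro rfl
    rw [map_zero, zero_mul] at hc
    obtain ⟨a, b, hab⟩ := hP.ker _ hc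
    obtain ⟨s, hs, hs1⟩ := sat0 (t1 := b) (t2 := -a) h1 hr hP e1 (by rw [hv, hab]; congr 1; ring)
    obtain ⟨g, hgI, hgJ⟩ := hN
    exact hgJ (free_case hg hr hrp hs hs1 hP hgI)
  obtain ⟨a, b, hab⟩ := hP.ker (v - C c * l3 ^ (1 + e)) (by
    rw [map_sub, map_mul, map_pow, hP.p3, hc]
    have : π (C c) = Polynomial.C c := π.commutes c
    rw [this, sub_self])
  have hL : C c * l3 ^ (1 + e) ∈ Sgr (1 + e) := Sgr_C_mul c (Sgr_pow hP.h3 _)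
  have hab' := congrArg (homogeneousComponent (1 + e)) hab
  rw [hc_self (Submodule.sub_mem _ hvh hL), map_add, hc_mul hP.h1, hc_mul hP.h2] at hab'
  set a' := homogeneousComponent e a
  set b' := homogeneousComponent e b
  have ha' : a' ∈ Sgr e := hc_mem _ _
  have hb' : b' ∈ Sgr e := hc_mem _ _
  refine ⟨c, hc0, s1 - b' • r, s2 + a' • r, ?_, ?_, ?_, ?_, ?_, ?_, ?_⟩
  · exact Submodule.sub_mem _ h1 (Submodule.smul_mem _ _ hr)
  · exact Submodule.add_mem _ h2 (Submodule.smul_mem _ _ hr)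
  · intro i
    refine Submodule.sub_mem _ (h1h i) ?_
    rw [add_comm]
    exact Sgr_mul hb' (hrh i)
  · intro i
    refine Submodule.add_mem _ (h2h i) ?_
    rw [add_comm]
    exact Sgr_mul ha' (hrh i)
  · have := e1.sub ((Ph.self f r).smul b')
    rwa [mul_zero, sub_zero] at this
  · have := e2.add ((Ph.self f r).smul a')
    rwa [mul_zero, add_zero] at this
  · have h : C c * l3 ^ (1 + e) = v - (l1 * a' + l2 * b') := by rw [← hab']; ring
    rw [h, sub_smul, ← hv]
    module

/-- The map `R p = p0 r + p1 s1 + p2 s2`. -/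
def Rm (r s1 s2 : Fin 3 → S) : (Fin 3 → S) →ₗ[S] (Fin 3 → S) :=
  Fintype.linearCombination S ![r, s1, s2]

lemma Rm_apply (r s1 s2 p : Fin 3 → S) : Rm r s1 s2 p = p 0 • r + p 1 • s1 + p 2 • s2 := by
  simp [Rm, Fintype.linearCombination_apply, Fin.sum_univ_three]

lemma Rm_range {f : S} (hg : Prim (grad f)) {r s1 s2 : Fin 3 → S}
    (hr : r ∈ ARmod f) (hrp : Prim r)
    (h1 : s1 ∈ ARmod f) (h2 : s2 ∈ ARmod f)
    {l1 l2 l3 : S} {π : S →ₐ[ℂ] Polynomial ℂ} (hP : Pencil l1 l2 l3 π)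
    (e1 : Ph f r s1 l1) (e2 : Ph f r s2 l2) (hN : ∃ g ∈ Isat f, g ∉ Jf f) :
    LinearMap.range (Rm r s1 s2) = ARmod f := by
  apply le_antisymm
  · rintro _ ⟨p, rfl⟩
    rw [Rm_apply]
    exact Submodule.add_mem _ (Submodule.add_mem _ (Submodule.smul_mem _ _ hr)
      (Submodule.smul_mem _ _ h1)) (Submodule.smul_mem _ _ h2)
  · intro t ht
    obtain ⟨h, hh⟩ := phi_exists hg hr ht
    have hh : Ph f r t h := hh
    have hz : π h = 0 := by
      by_contra hne
      obtain ⟨s, hs, hs1⟩ := sat1 h1 hr hrp hP e1 e2 hh hne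
      obtain ⟨g, hgI, hgJ⟩ := hN
      exact hgJ (free_case hg hr hrp hs hs1 hP hgI)
    obtain ⟨a, b, hab⟩ := hP.ker _ hz
    have h3 := (hh.sub (e1.smul a)).sub (e2.smul b)
    rw [hab, show l1 * a + l2 * b - a * l1 - b * l2 = 0 by ring] at h3
    obtain ⟨p, hp⟩ := h3.ker hrp
    refine ⟨![p, a, b], ?_⟩
    rw [Rm_apply]
    simp only [Matrix.cons_val, ← hp]
    module

lemma Rm_ker {f : S} (hg : Prim (grad f)) {r s1 s2 : Fin 3 → S} (hrp : Prim r)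
    {l1 l2 l3 L : S} {π : S →ₐ[ℂ] Polynomial ℂ} (hP : Pencil l1 l2 l3 π)
    (e1 : Ph f r s1 l1) (e2 : Ph f r s2 l2)
    (rel : l2 • s1 - l1 • s2 = L • r) :
    LinearMap.ker (Rm r s1 s2) = Submodule.span S {![L, -l2, l1]} := by
  apply le_antisymm
  · intro p hp
    have hp : Rm r s1 s2 p = 0 := hp
    rw [Rm_apply] at hp
    have e := (((Ph.self f r).smul (p 0)).add (e1.smul (p 1))).add (e2.smul (p 2))
    rw [hp] at e
    have e0 : Ph f r 0 0 := by unfold Ph; simp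
    have hp1 := e.uniq hg e0
    have hreg : Reg3 l1 l2 l3 := hP.reg (by rw [hP.p3]; exact Polynomial.X_ne_zero)
    obtain ⟨q, hq1, hq2⟩ := hreg.k2 (a := p 2) (b := - p 1) (by linear_combination hp1)
    have hq3 : p 1 = -(l2 * q) := by linear_combination -hq2
    have hq0 : p 0 = q * L := by
      apply hrp.smul_eq
      rw [mul_smul, ← rel]
      rw [hq1, hq3] at hp
      rw [← sub_eq_zero, ← hp]
      module
    rw [Submodule.mem_span_singleton]
    refine ⟨q, ?_⟩
    funext i
    fin_cases i
    · simp [hq0]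
    · simp [hq3, mul_comm]
    · simp [hq1, mul_comm]
  · rw [Submodule.span_singleton_le_iff_mem]
    change Rm r s1 s2 _ = 0
    rw [Rm_apply]
    simp only [Matrix.cons_val]
    rw [← rel]
    module

lemma exists_g0 {f : S} {d d1 e : ℕ} (hf : f.IsHomogeneous d) (hd : 2 ≤ d)
    {r s1 s2 : Fin 3 → S} (hr0 : r ≠ 0)
    (hr : r ∈ ARmod f) (hrh : IsHomRel r d1)
    (h1 : s1 ∈ ARmod f) (h1h : IsHomRel s1 (d1 + e))
    (h2h : IsHomRel s2 (d1 + e))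
    {l1 l2 L : S} (hl1 : l1 ∈ Sgr 1) (hl2 : l2 ∈ Sgr 1) (hL : L ∈ Sgr (1 + e))
    (hreg : Reg3 l1 l2 L) (rel : l2 • s1 - l1 • s2 = L • r) :
    ∃ g0 ∈ Sgr (d + d1 - 3), 1 ≤ d1 ∧ Dat f (Rm r s1 s2) ![L, -l2, l1] l1 l2 L g0 1 := by
  obtain ⟨u1, u2, u3, z1, z2, z3⟩ := hreg.koszulv (p1 := r) (p2 := s1) (p3 := s2) (by
    rw [← rel]; module)
  have hd1 : 1 ≤ d1 := by
    by_contra hlt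
    have h0 : d1 = 0 := by omega
    subst h0
    apply hr0
    funext i
    have := congrArg (homogeneousComponent 0) (congrFun z1 i)
    simp only [Pi.sub_apply, Pi.smul_apply, smul_eq_mul] at this
    rw [hc_self (hrh i), map_sub, hc_mul_lt hl2 one_pos, hc_mul_lt hl1 one_pos, sub_zero] at this
    exact this
  obtain ⟨m, rfl⟩ := Nat.exists_eq_add_of_le hd1
  set v1 : Fin 3 → S := fun i => homogeneousComponent m (u1 i)
  set v2 : Fin 3 → S := fun i => homogeneousComponent m (u2 i)
  set v3 : Fin 3 → S := fun i => homogeneousComponent (m + e) (u3 i)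
  have y1 : r = l2 • v1 - l1 • v2 := by
    funext i
    have := congrArg (homogeneousComponent (1 + m)) (congrFun z1 i)
    simp only [Pi.sub_apply, Pi.smul_apply, smul_eq_mul] at this
    rw [hc_self (hrh i), map_sub, hc_mul hl2, hc_mul hl1] at this
    exact this
  have y2 : s1 = L • v1 - l1 • v3 := by
    funext i
    have := congrArg (homogeneousComponent (1 + m + e)) (congrFun z2 i)
    simp only [Pi.sub_apply, Pi.smul_apply, smul_eq_mul] at this
    rw [hc_self (h1h i), map_sub, show 1 + m + e = (1 + e) + m by ring, hc_mul hL,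
      show (1 + e) + m = 1 + (m + e) by ring, hc_mul hl1] at this
    exact this
  have y3 : s2 = L • v2 - l2 • v3 := by
    funext i
    have := congrArg (homogeneousComponent (1 + m + e)) (congrFun z3 i)
    simp only [Pi.sub_apply, Pi.smul_apply, smul_eq_mul] at this
    rw [hc_self (h2h i), map_sub, show 1 + m + e = (1 + e) + m by ring, hc_mul hL,
      show (1 + e) + m = 1 + (m + e) by ring, hc_mul hl2] at this
    exact this
  have E1 : l2 * eqnMap f v1 = l1 * eqnMap f v2 := by
    have : eqnMap f r = 0 := hr
    rw [y1, map_sub, map_smul, map_smul, smul_eq_mul, smul_eq_mul] at this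
    exact sub_eq_zero.1 this
  obtain ⟨g0, k1, k2⟩ := hreg.k2 E1
  have E3 : eqnMap f v3 = L * g0 := by
    have : eqnMap f s1 = 0 := h1
    rw [y2, map_sub, map_smul, map_smul, smul_eq_mul, smul_eq_mul, k1] at this
    apply mul_left_cancel₀ hreg.a0
    linear_combination -this
  refine ⟨g0, ?_, hd1, v1, v2, v3, ![1, 0, 0], ![0, 1, 0], ![0, 0, 1], k1.symm, k2.symm, E3.symm,
    ?_, ?_, ?_, ?_⟩
  · refine Sgr_quot hl1 hreg.a0 ?_
    rw [← k1, eqnMap_apply, show 1 + (d + (1 + m) - 3) = m + (d - 1) by omega]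
    have : ∀ i, v1 i * grad f i ∈ Sgr (m + (d - 1)) := fun i => Sgr_mul (hc_mem _ _) (grad_mem hf i)
    exact Submodule.add_mem _ (Submodule.add_mem _ (this 0) (this 1)) (this 2)
  · rw [Rm_apply]; simp [← y1]
  · rw [Rm_apply]; simp [← y2]
  · rw [Rm_apply]; simp [← y3]
  · funext i; fin_cases i <;> simp

lemma Dat.inv {ι : Type} {f : S} {R : (ι → S) →ₗ[S] (Fin 3 → S)} {ρ : ι → S} {A B C g w : S}
    (hR : LinearMap.range R = ARmod f) (hk : LinearMap.ker R = Submodule.span S {ρ})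
    (hρ : ρ ≠ 0) (h : Dat f R ρ A B C g w) (hg : g ∈ Jf f) :
    ∃ a b c, w = A * a + B * b + C * c := by
  obtain ⟨u1, u2, u3, p1, p2, p3, a1, a2, a3, e1, e2, e3, e4⟩ := h
  obtain ⟨U, rfl⟩ := (mem_Jf_iff f g).1 hg
  have key : ∀ (A : S) (u : Fin 3 → S), A * eqnMap f U = eqnMap f u → ∃ p, R p = u - A • U := by
    intro A u hu
    have : u - A • U ∈ ARmod f := by
      change eqnMap f _ = 0
      rw [map_sub, map_smul, smul_eq_mul, hu, sub_self]
    rw [← hR] at this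
    exact this
  obtain ⟨q1, h1⟩ := key _ _ a1
  obtain ⟨q2, h2⟩ := key _ _ a2
  obtain ⟨q3, h3⟩ := key _ _ a3
  have key2 : ∀ p, R p = 0 → ∃ t : S, p = t • ρ := by
    intro p hp
    have : p ∈ LinearMap.ker R := hp
    rw [hk, Submodule.mem_span_singleton] at this
    obtain ⟨t, ht⟩ := this
    exact ⟨t, ht.symm⟩
  obtain ⟨t1, y1⟩ := key2 (B • q1 - A • q2 - p1) (by
    rw [map_sub, map_sub, map_smul, map_smul, h1, h2, ← e1]; module)
  obtain ⟨t2, y2⟩ := key2 (C • q1 - A • q3 - p2) (by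
    rw [map_sub, map_sub, map_smul, map_smul, h1, h3, ← e2]; module)
  obtain ⟨t3, y3⟩ := key2 (C • q2 - B • q3 - p3) (by
    rw [map_sub, map_sub, map_smul, map_smul, h2, h3, ← e3]; module)
  refine ⟨-t3, t2, -t1, ?_⟩
  have : w • ρ = (A * -t3 + B * t2 + C * -t1) • ρ := by
    have : (A * -t3 + B * t2 + C * -t1) • ρ = -(A • (t3 • ρ)) + B • (t2 • ρ) - C • (t1 • ρ) := by
      module
    rw [this, ← y1, ← y2, ← y3, ← e4]
    module
  obtain ⟨i, hi⟩ := Function.ne_iff.1 hρ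
  exact mul_right_cancel₀ hi (congrFun this i)

section main
variable {f : S} {d d1 e : ℕ} {r s1 s2 : Fin 3 → S} {l1 l2 l3 L g0 : S} {c : ℂ}
  {π : S →ₐ[ℂ] Polynomial ℂ}

lemma pi_L (hP : Pencil l1 l2 l3 π) (hLd : L = C c * l3 ^ (1 + e)) :
    π L = Polynomial.C c * Polynomial.X ^ (1 + e) := by
  rw [hLd, map_mul, map_pow, hP.p3]
  have : π (C c) = Polynomial.C c := π.commutes c
  rw [this]

lemma mem_lL (hP : Pencil l1 l2 l3 π) (hc : c ≠ 0) (hLd : L = C c * l3 ^ (1 + e)) {w : S}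
    (hw : Polynomial.X ^ (1 + e) ∣ π w) : ∃ a b y, w = l1 * a + l2 * b + L * y := by
  obtain ⟨y, hy⟩ := hw
  have h3 : π (C c⁻¹ * Polynomial.aeval l3 y) = Polynomial.C c⁻¹ * y := by
    have : π (C c⁻¹) = Polynomial.C c⁻¹ := π.commutes c⁻¹
    rw [map_mul, this, ← Polynomial.aeval_algHom_apply, hP.p3, Polynomial.aeval_X_left_apply]
  obtain ⟨a, b, hab⟩ := hP.ker (w - L * (C c⁻¹ * Polynomial.aeval l3 y)) (by
    rw [map_sub, map_mul, h3, pi_L hP hLd, hy]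
    have : Polynomial.C c * Polynomial.C c⁻¹ = 1 := by
      rw [← Polynomial.C_mul, mul_inv_cancel₀ hc, Polynomial.C_1]
    linear_combination (-(Polynomial.X ^ (1 + e) * y)) * this)
  exact ⟨a, b, C c⁻¹ * Polynomial.aeval l3 y, by linear_combination hab⟩

lemma g0_nonvan (hP : Pencil l1 l2 l3 π) (hLd : L = C c * l3 ^ (1 + e))
    (hR : LinearMap.range (Rm r s1 s2) = ARmod f)
    (hk : LinearMap.ker (Rm r s1 s2) = Submodule.span S {![L, -l2, l1]})
    (h : Dat f (Rm r s1 s2) ![L, -l2, l1] l1 l2 L g0 1) {q : S} (hq : q * g0 ∈ Jf f) :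
    Polynomial.X ^ (1 + e) ∣ π q := by
  have hρ : ![L, -l2, l1] ≠ 0 := by
    intro h0
    exact hP.n1 (congrFun h0 2)
  obtain ⟨a, b, y, hy⟩ := (h.smul q).inv hR hk hρ hq
  rw [mul_one] at hy
  rw [hy, map_add, map_add, map_mul, map_mul, map_mul, hP.p1, hP.p2, pi_L hP hLd]
  exact ⟨Polynomial.C c * π y, by ring⟩

lemma g0_van (hP : Pencil l1 l2 l3 π) (hc : c ≠ 0) (hLd : L = C c * l3 ^ (1 + e))
    (hR : LinearMap.range (Rm r s1 s2) = ARmod f)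
    (hk : LinearMap.ker (Rm r s1 s2) = Submodule.span S {![L, -l2, l1]})
    (hreg : Reg3 l1 l2 L)
    (h : Dat f (Rm r s1 s2) ![L, -l2, l1] l1 l2 L g0 1) {w : S}
    (hw : Polynomial.X ^ (1 + e) ∣ π w) : w * g0 ∈ Jf f := by
  have hρ0 : Rm r s1 s2 ![L, -l2, l1] = 0 := by
    have : ![L, -l2, l1] ∈ LinearMap.ker (Rm r s1 s2) := by
      rw [hk]; exact Submodule.mem_span_singleton_self _
    exact this
  have := h.smul w
  rw [mul_one] at this
  exact this.mem hR hρ0 hreg (mem_lL hP hc hLd hw)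

lemma g0_sat (hP : Pencil l1 l2 l3 π) (hc : c ≠ 0) (hLd : L = C c * l3 ^ (1 + e))
    (hR : LinearMap.range (Rm r s1 s2) = ARmod f)
    (hk : LinearMap.ker (Rm r s1 s2) = Submodule.span S {![L, -l2, l1]})
    (hreg : Reg3 l1 l2 L)
    (h : Dat f (Rm r s1 s2) ![L, -l2, l1] l1 l2 L g0 1) : g0 ∈ Isat f := by
  rw [mem_Isat]
  refine ⟨1 + e, fun w hw => g0_van hP hc hLd hR hk hreg h ?_⟩
  have hm : mId ≤ Ideal.comap π (Ideal.span {Polynomial.X}) := by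
    have hX : ∀ i : Fin 3, (X i : S) ∈ Ideal.comap π (Ideal.span {Polynomial.X}) := by
      intro i
      obtain ⟨a, ha⟩ := hP.hom 1 (X i) (isHomogeneous_X _ _)
      rw [Ideal.mem_comap, Ideal.mem_span_singleton, ha, pow_one]
      exact dvd_mul_left _ _
    unfold mId
    rw [Ideal.span_le]
    rintro x (rfl | rfl | rfl)
    · exact hX 0
    · exact hX 1
    · exact hX 2
  have := Ideal.le_comap_pow π (1 + e) (Ideal.pow_right_mono hm (1 + e) hw)
  rwa [Ideal.mem_comap, Ideal.span_singleton_pow, Ideal.mem_span_singleton] at this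

lemma sat_gen (hP : Pencil l1 l2 l3 π)
    (hR : LinearMap.range (Rm r s1 s2) = ARmod f)
    (hk : LinearMap.ker (Rm r s1 s2) = Submodule.span S {![L, -l2, l1]})
    (hreg : Reg3 l1 l2 L)
    (h : Dat f (Rm r s1 s2) ![L, -l2, l1] l1 l2 L g0 1) {g : S} (hg : g ∈ Isat f) :
    ∃ w : S, g - w * g0 ∈ Jf f := by
  have hρ0 : Rm r s1 s2 ![L, -l2, l1] = 0 := by
    have : ![L, -l2, l1] ∈ LinearMap.ker (Rm r s1 s2) := by
      rw [hk]; exact Submodule.mem_span_singleton_self _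
    exact this
  obtain ⟨n, hn⟩ := (mem_Isat f g).1 hg
  have hl : ∀ l ∈ Sgr 1, l ^ n * g ∈ Jf f := fun l hl => hn _ (Ideal.pow_mem_pow (Sgr1_mId hl) n)
  obtain ⟨w, hw⟩ := Dat.exists hR hk (hl l1 hP.h1) (hl l2 hP.h2) (hl l3 hP.h3)
  have hreg' : Reg3 (l1 ^ n) (l2 ^ n) (l3 ^ n) := by
    refine Reg3.pow (hP.reg ?_) n n
    rw [map_pow, hP.p3]
    exact pow_ne_zero _ Polynomial.X_ne_zero
  have key : ∀ i, ![L, -l2, l1] i * g ∈ Jf f := by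
    intro i
    refine (hw.smul _).mem hR hρ0 hreg' ?_
    rw [mul_comm]
    exact hw.rho i
  have k1 : l1 * g ∈ Jf f := key 2
  have k2 : l2 * g ∈ Jf f := by
    have := Ideal.neg_mem_iff _ |>.2 (key 1)
    simpa using this
  have k3 : L * g ∈ Jf f := key 0
  obtain ⟨w', hw'⟩ := Dat.exists hR hk k1 k2 k3
  refine ⟨w', ?_⟩
  have := hw'.sub (h.smul w')
  rw [mul_one, sub_self] at this
  exact this.mem hR hρ0 hreg ⟨0, 0, 0, by simp⟩

end main

/-- The structure theorem. -/
lemma structure_thm {f : S} {d d1 e : ℕ} (hf : f.IsHomogeneous d) (hd : 2 ≤ d)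
    (hg : Prim (grad f)) {r s1 s2 : Fin 3 → S}
    (hr : r ∈ ARmod f) (hrp : Prim r) (hrh : IsHomRel r d1)
    (h1 : s1 ∈ ARmod f) (h2 : s2 ∈ ARmod f) (h1h : IsHomRel s1 (d1 + e))
    (h2h : IsHomRel s2 (d1 + e))
    {l1 l2 l3 : S} {π : S →ₐ[ℂ] Polynomial ℂ} (hP : Pencil l1 l2 l3 π)
    (e1 : Ph f r s1 l1) (e2 : Ph f r s2 l2) (hN : ∃ g ∈ Isat f, g ∉ Jf f) (k : ℕ) :
    ((d + d1 ≤ k + 3 ∧ k + 3 ≤ d + d1 + e) → ∃ g ∈ Isat f, g ∈ Sgr k ∧ g ∉ Jf f) ∧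
    ((k + 3 < d + d1 ∨ d + d1 + e < k + 3) → ∀ g ∈ Isat f, g ∈ Sgr k → g ∈ Jf f) := by
  obtain ⟨c, hc, s1, s2, h1, h2, h1h, h2h, e1, e2, rel⟩ :=
    norm_rel hg hr hrp hrh h1 h2 h1h h2h hP e1 e2 hN
  obtain ⟨L, hLd⟩ : ∃ L, L = C c * l3 ^ (1 + e) := ⟨_, rfl⟩
  rw [← hLd] at rel
  have hL : L ∈ Sgr (1 + e) := by rw [hLd]; exact Sgr_C_mul c (Sgr_pow hP.h3 _)
  have hreg : Reg3 l1 l2 L := hP.reg (by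
    rw [pi_L hP hLd]
    exact mul_ne_zero (Polynomial.C_ne_zero.2 hc) (pow_ne_zero _ Polynomial.X_ne_zero))
  have hR := Rm_range hg hr hrp h1 h2 hP e1 e2 hN
  have hk := Rm_ker hg hrp hP e1 e2 rel
  have hr0 : r ≠ 0 := by
    rintro rfl
    obtain ⟨j, hj⟩ := hrp.ne
    exact hj rfl
  obtain ⟨g0, hg0, hd1, hD⟩ := exists_g0 hf hd hr0 hr hrh h1 h1h h2h hP.h1 hP.h2 hL hreg rel
  constructor
  · rintro ⟨ha, hb⟩
    refine ⟨l3 ^ (k + 3 - (d + d1)) * g0, Ideal.mul_mem_left _ _ (g0_sat hP hc hLd hR hk hreg hD),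
      ?_, ?_⟩
    · have := Sgr_mul (Sgr_pow hP.h3 (k + 3 - (d + d1))) hg0
      rwa [show k + 3 - (d + d1) + (d + d1 - 3) = k by omega] at this
    · intro hmem
      have := g0_nonvan hP hLd hR hk hD hmem
      rw [map_pow, hP.p3, pow_dvd_pow_iff Polynomial.X_ne_zero Polynomial.not_isUnit_X] at this
      omega
  · intro hor g hgI hgk
    obtain ⟨w, hw⟩ := sat_gen hP hR hk hreg hD hgI
    have := Jf_hc hf hw k
    rw [map_sub, hc_self hgk, mul_comm w g0] at this
    rcases hor with hlt | hgt
    · rwa [hc_mul_lt hg0 (by omega), sub_zero] at this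
    · obtain ⟨m, rfl⟩ := Nat.exists_eq_add_of_le (show d + d1 - 3 ≤ k by omega)
      rw [hc_mul hg0, mul_comm] at this
      obtain ⟨b, hb⟩ := hP.hom m _ (hc_mem m w)
      have h3 : homogeneousComponent m w * g0 ∈ Jf f := by
        refine g0_van hP hc hLd hR hk hreg hD ?_
        rw [hb]
        exact Dvd.dvd.mul_left (pow_dvd_pow _ (by omega)) _
      have := Ideal.add_mem _ this h3
      rwa [sub_add_cancel] at this

lemma Sgr_finrank (n : ℕ) : Module.finrank ℂ (Sgr n) = (n + 2).choose 2 := by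
  classical
  let T : Finset (Fin 3 →₀ ℕ) := Finset.finsuppAntidiag Finset.univ n
  let b : T → S := fun m => monomial m.1 (1 : ℂ)
  have hb : LinearIndependent ℂ b := by
    have := (basisMonomials (Fin 3) ℂ).linearIndependent.comp (fun m : T => m.1)
      Subtype.val_injective
    have hbe : b = (basisMonomials (Fin 3) ℂ) ∘ (fun m : T => m.1) := by
      funext m
      simp [b]
    rw [hbe]
    exact this
  have hT : ∀ m : Fin 3 →₀ ℕ, m ∈ T ↔ m.degree = n := by
    intro m
    simp [T, Finset.mem_finsuppAntidiag, Finsupp.degree_eq_sum]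
  have hspan : Sgr n = Submodule.span ℂ (Set.range b) := by
    unfold Sgr
    rw [homogeneousSubmodule_eq_finsupp_supported, AddMonoidAlgebra.supported_eq_span_single]
    congr 1
    ext x
    constructor
    · rintro ⟨m, hm, rfl⟩
      exact ⟨⟨m, (hT m).2 hm⟩, rfl⟩
    · rintro ⟨m, rfl⟩
      exact ⟨m.1, (hT _).1 m.2, rfl⟩
  rw [hspan, finrank_span_eq_card hb, Fintype.card_coe]
  simp only [T]
  rw [Finset.card_finsuppAntidiag_nat_eq_choose]
  simp only [Finset.card_univ, Fintype.card_fin]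
  rw [show 3 + n - 1 = n + 2 by omega]
  exact Nat.choose_symm_add

instance Sgr_fd (n : ℕ) : FiniteDimensional ℂ (Sgr n) :=
  Module.Finite.iff_fg.2 (homogeneousSubmodule_fg _ _ n)

lemma Isat_sat {f g : S} (h : ∀ i : Fin 3, X i * g ∈ Isat f) : g ∈ Isat f := by
  simp only [mem_Isat] at h
  choose n hn using h
  rw [mem_Isat]
  refine ⟨(n 0 + n 1 + n 2) + 1, fun w hw => ?_⟩
  have hle : ∀ i, n i ≤ n 0 + n 1 + n 2 := by
    intro i; fin_cases i <;> simp <;> omega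
  rw [pow_succ] at hw
  have hmul : mId ^ (n 0 + n 1 + n 2) * mId ≤ Submodule.colon (Jf f) {g} := by
    rw [Ideal.mul_le]
    intro a ha b hb
    have : mId ≤ Submodule.colon (Jf f) {a * g} := by
      unfold mId
      rw [Ideal.span_le]
      have : ∀ i, (X i : S) * (a * g) ∈ Jf f := by
        intro i
        have := hn i a (Ideal.pow_le_pow_right (hle i) ha)
        rwa [mul_left_comm]
      rintro x (rfl | rfl | rfl) <;> simp only [SetLike.mem_coe, Submodule.mem_colon_singleton, smul_eq_mul] <;> apply this
    have := this hb
    rw [Submodule.mem_colon_singleton, smul_eq_mul] at this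
    rwa [Submodule.mem_colon_singleton, smul_eq_mul, mul_comm a b, mul_assoc]
  have := hmul hw
  rwa [Submodule.mem_colon_singleton, smul_eq_mul] at this

lemma exists_reg (f : S) : ∃ l ∈ Sgr 1, l ≠ 0 ∧ ∀ g, l * g ∈ Isat f → g ∈ Isat f := by
  classical
  let M := S ⧸ (Isat f)
  have hfin : (associatedPrimes S M).Finite := associatedPrimes.finite S M
  let V : Ideal S → Submodule ℂ (Sgr 1) := fun P =>
    (P.restrictScalars ℂ).comap (Sgr 1).subtype
  let s : Finset (Submodule ℂ (Sgr 1)) := insert ⊥ (hfin.toFinset.image V)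
  have htop : ⊤ ∉ s := by
    simp only [s, Finset.mem_insert, Finset.mem_image, Set.Finite.mem_toFinset, not_or, not_exists,
      not_and]
    constructor
    · intro h0
      have : (⟨X 0, isHomogeneous_X _ _⟩ : Sgr 1) ∈ (⊤ : Submodule ℂ (Sgr 1)) := trivial
      rw [h0, Submodule.mem_bot] at this
      exact X_ne_zero (R := ℂ) (0 : Fin 3) (congrArg Subtype.val this)
    · intro P hP hV
      rw [AssociatedPrimes.mem_iff, isAssociatedPrime_iff] at hP
      obtain ⟨hpr, x, hx⟩ := hP
      obtain ⟨g, rfl⟩ := Submodule.Quotient.mk_surjective _ x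
      apply hpr.ne_top
      have hg : g ∈ Isat f := by
        apply Isat_sat
        intro i
        have : (⟨X i, isHomogeneous_X _ _⟩ : Sgr 1) ∈ V P := by rw [hV]; trivial
        have h2 : (X i : S) ∈ P := this
        rw [hx, Submodule.mem_colon_singleton, Submodule.mem_bot, ← Submodule.Quotient.mk_smul,
          Submodule.Quotient.mk_eq_zero] at h2
        exact h2
      rw [hx, Ideal.eq_top_iff_one, Submodule.mem_colon_singleton, Submodule.mem_bot, one_smul,
        Submodule.Quotient.mk_eq_zero]
      exact hg
  have := Subspace.biUnion_ne_univ_of_top_notMem htop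
  rw [Set.ne_univ_iff_exists_notMem] at this
  obtain ⟨l, hl⟩ := this
  simp only [Set.mem_iUnion, not_exists] at hl
  refine ⟨l.1, l.2, ?_, ?_⟩
  · intro h0
    apply hl ⊥ (Finset.mem_insert_self _ _)
    exact (Submodule.mem_bot ℂ).2 (Subtype.ext h0)
  · intro g hg
    by_contra hgn
    have hz : l.1 ∈ {r : S | ∃ x : M, x ≠ 0 ∧ r • x = 0} := by
      refine ⟨Submodule.Quotient.mk g, ?_, ?_⟩
      · rwa [Ne, Submodule.Quotient.mk_eq_zero]
      · rw [← Submodule.Quotient.mk_smul, Submodule.Quotient.mk_eq_zero]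
        exact hg
    rw [← biUnion_associatedPrimes_eq_zero_divisors S M] at hz
    simp only [Set.mem_iUnion] at hz
    obtain ⟨P, hP, hlP⟩ := hz
    exact hl (V P) (Finset.mem_insert_of_mem (Finset.mem_image_of_mem _ (hfin.mem_toFinset.2 hP))) hlP

lemma reg_pow {f l : S} (h : ∀ g, l * g ∈ Isat f → g ∈ Isat f) (s : ℕ) (g : S)
    (hg : l ^ s * g ∈ Isat f) : g ∈ Isat f := by
  induction s with
  | zero => simpa using hg
  | succ n ih =>
    apply ih
    apply h
    rwa [← mul_assoc, ← pow_succ']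

/-- Degree `k` part of the Jacobian ideal. -/
def Jk (f : S) (k : ℕ) : Submodule ℂ S := ((Jf f).restrictScalars ℂ) ⊓ Sgr k
/-- Degree `k` part of the saturation. -/
def Ik (f : S) (k : ℕ) : Submodule ℂ S := ((Isat f).restrictScalars ℂ) ⊓ Sgr k

instance (f : S) (k : ℕ) : FiniteDimensional ℂ (Jk f k) :=
  Submodule.finiteDimensional_of_le (inf_le_right : _ ≤ Sgr k)
instance (f : S) (k : ℕ) : FiniteDimensional ℂ (Ik f k) :=
  Submodule.finiteDimensional_of_le (inf_le_right : _ ≤ Sgr k)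

lemma Jf_le_Isat (f : S) : Jf f ≤ Isat f := by
  intro g hg
  rw [mem_Isat]
  exact ⟨0, fun w _ => Ideal.mul_mem_left _ _ hg⟩

lemma quotC_eq_zero {f g : S} : quotC f g = 0 ↔ g ∈ Jf f := by
  exact Submodule.Quotient.mk_eq_zero _

lemma Ik_le (f : S) (k : ℕ) :
    Module.finrank ℂ (Ik f k) ≤ Module.finrank ℂ (Jk f k) + ndim f k := by
  let φ : Ik f k →ₗ[ℂ] (S ⧸ (Jf f : Submodule S S)) := (quotC f).domRestrict (Ik f k)
  have h := φ.finrank_range_add_finrank_ker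
  have h1 : LinearMap.range φ = Nsub f k := by
    rw [LinearMap.range_domRestrict]; rfl
  have h2 : Module.finrank ℂ (LinearMap.ker φ) ≤ Module.finrank ℂ (Jk f k) := by
    let ψ : LinearMap.ker φ →ₗ[ℂ] Jk f k :=
      LinearMap.codRestrict _ ((Ik f k).subtype ∘ₗ (LinearMap.ker φ).subtype) (by
        rintro ⟨⟨g, hg⟩, hk⟩
        exact ⟨quotC_eq_zero.1 hk, hg.2⟩)
    refine LinearMap.finrank_le_finrank_of_injective (f := ψ) ?_
    intro a b hab
    have := congrArg Subtype.val hab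
    exact Subtype.ext (Subtype.ext this)
  rw [h1] at h
  unfold ndim
  omega

lemma dim_ineq {f l : S} (hl : l ∈ Sgr 1) (hl0 : l ≠ 0) (h : ∀ g, l * g ∈ Isat f → g ∈ Isat f)
    (k s : ℕ) :
    Module.finrank ℂ (Sgr k) + Module.finrank ℂ (Jk f (k + s)) ≤
      Module.finrank ℂ (Sgr (k + s)) + Module.finrank ℂ (Ik f k) := by
  let μ : S →ₗ[ℂ] S := LinearMap.mulLeft ℂ (l ^ s)
  have hμ : Function.Injective μ := fun a b hab => mul_left_cancel₀ (pow_ne_zero s hl0) hab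
  let A := (Sgr k).map μ
  have hA : Module.finrank ℂ A = Module.finrank ℂ (Sgr k) := 
    (LinearEquiv.finrank_eq (Submodule.equivMapOfInjective μ hμ (Sgr k))).symm
  have hAB : A ⊔ Jk f (k + s) ≤ Sgr (k + s) := by
    refine sup_le ?_ inf_le_right
    rintro _ ⟨g, hg, rfl⟩
    rw [add_comm]
    exact Sgr_mul (Sgr_pow hl s) hg
  have hAB' : A ⊓ Jk f (k + s) ≤ (Ik f k).map μ := by
    rintro _ ⟨⟨g, hg, rfl⟩, hJ⟩
    exact ⟨g, ⟨reg_pow h s g (Jf_le_Isat f hJ.1), hg⟩, rfl⟩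
  have h1 := Submodule.finrank_sup_add_finrank_inf_eq A (Jk f (k + s))
  have h2 := Submodule.finrank_mono hAB
  have h3 := Submodule.finrank_mono hAB'
  have h4 := Submodule.finrank_map_le μ (Ik f k)
  omega

/-- Evaluation of `eqnMap` on triples of degree `j`. -/
def Tm (f : S) (j : ℕ) : (Fin 3 → Sgr j) →ₗ[ℂ] S :=
  (eqnMap f).restrictScalars ℂ ∘ₗ LinearMap.pi (fun i => (Sgr j).subtype ∘ₗ LinearMap.proj i)

lemma Tm_apply (f : S) (j : ℕ) (u : Fin 3 → Sgr j) : Tm f j u = eqnMap f (fun i => (u i : S)) := rfl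

/-- Relations of degree `j`. -/
def Kk (f : S) (j : ℕ) : Submodule ℂ (Fin 3 → Sgr j) := LinearMap.ker (Tm f j)

lemma Tm_range {f : S} {d : ℕ} (hf : f.IsHomogeneous d) (j : ℕ) :
    LinearMap.range (Tm f j) = Jk f (d - 1 + j) := by
  apply le_antisymm
  · rintro _ ⟨u, rfl⟩
    rw [Tm_apply]
    refine ⟨(mem_Jf_iff _ _).2 ⟨_, rfl⟩, ?_⟩
    rw [eqnMap_apply, add_comm]
    have : ∀ i, (u i : S) * grad f i ∈ Sgr (j + (d - 1)) := fun i => Sgr_mul (u i).2 (grad_mem hf i)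
    exact Submodule.add_mem _ (Submodule.add_mem _ (this 0) (this 1)) (this 2)
  · rintro g ⟨hg, hgk⟩
    obtain ⟨u, hu⟩ := (mem_Jf_iff _ _).1 hg
    refine ⟨fun i => ⟨homogeneousComponent j (u i), hc_mem _ _⟩, ?_⟩
    rw [Tm_apply, eqnMap_apply]
    rw [eqnMap_apply, mul_comm (u 0), mul_comm (u 1), mul_comm (u 2)] at hu
    have := congrArg (homogeneousComponent (d - 1 + j)) hu
    rw [hc_self hgk, map_add, map_add, hc_mul (grad_mem hf 0), hc_mul (grad_mem hf 1),
      hc_mul (grad_mem hf 2)] at this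
    rw [← this]
    ring

lemma rank_null {f : S} {d : ℕ} (hf : f.IsHomogeneous d) (j : ℕ) :
    Module.finrank ℂ (Jk f (d - 1 + j)) + Module.finrank ℂ (Kk f j) = 3 * (j + 2).choose 2 := by
  have := (Tm f j).finrank_range_add_finrank_ker
  rw [Tm_range hf, Module.finrank_pi_fintype] at this
  simp only [Sgr_finrank, Finset.sum_const, Finset.card_univ, Fintype.card_fin, smul_eq_mul] at this
  exact this

lemma Jk_low {f : S} {d : ℕ} (hf : f.IsHomogeneous d) {k : ℕ} (hk : k < d - 1) :
    Module.finrank ℂ (Jk f k) = 0 := by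
  have : Jk f k = ⊥ := by
    rw [eq_bot_iff]
    rintro g ⟨hg, hgk⟩
    obtain ⟨u, hu⟩ := (mem_Jf_iff _ _).1 hg
    rw [eqnMap_apply, mul_comm (u 0), mul_comm (u 1), mul_comm (u 2)] at hu
    have := congrArg (homogeneousComponent k) hu
    rw [hc_self hgk, map_add, map_add, hc_mul_lt (grad_mem hf 0) hk, hc_mul_lt (grad_mem hf 1) hk,
      hc_mul_lt (grad_mem hf 2) hk] at this
    rw [Submodule.mem_bot, ← this]
    simp
  rw [this, finrank_bot]

lemma Kk_low {f : S} {d1 : ℕ} (hd1 : IsLeast (mdrSet f) d1) {j : ℕ} (hj : j < d1) :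
    Module.finrank ℂ (Kk f j) = 0 := by
  have : Kk f j = ⊥ := by
    rw [eq_bot_iff]
    intro u hu
    rw [Submodule.mem_bot]
    by_contra hne
    have : j ∈ mdrSet f := by
      refine ⟨fun i => (u i : S), hu, ?_, fun i => (u i).2⟩
      intro h0
      apply hne
      funext i
      exact Subtype.ext (congrFun h0 i)
    have := hd1.2 this
    omega
  rw [this, finrank_bot]

/-- Multiples of a relation. -/
def mulr {r : Fin 3 → S} {d1 : ℕ} (hrh : IsHomRel r d1) (m : ℕ) :
    Sgr m →ₗ[ℂ] (Fin 3 → Sgr (d1 + m)) where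
  toFun p := fun i => ⟨r i * p, Sgr_mul (hrh i) p.2⟩
  map_add' p q := by funext i; apply Subtype.ext; simp [mul_add]
  map_smul' c p := by funext i; apply Subtype.ext; simp

lemma mulr_finrank {r : Fin 3 → S} {d1 : ℕ} (hrh : IsHomRel r d1) (hr0 : r ≠ 0) (m : ℕ) :
    Module.finrank ℂ (LinearMap.range (mulr hrh m)) = (m + 2).choose 2 := by
  rw [LinearMap.finrank_range_of_inj, Sgr_finrank]
  intro p q hpq
  obtain ⟨i, hi⟩ := Function.ne_iff.1 hr0
  have := congrArg Subtype.val (congrFun hpq i)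
  exact Subtype.ext (mul_left_cancel₀ hi this)

lemma mulr_le {f : S} {r : Fin 3 → S} {d1 : ℕ} (hr : r ∈ ARmod f) (hrh : IsHomRel r d1) (m : ℕ) :
    LinearMap.range (mulr hrh m) ≤ Kk f (d1 + m) := by
  rintro _ ⟨p, rfl⟩
  change eqnMap f (fun i => ((mulr hrh m p) i : S)) = 0
  have h0 : eqnMap f r = 0 := hr
  have : (fun i => ((mulr hrh m p) i : S)) = (p : S) • r := by
    funext i
    simp [mulr, mul_comm]
  rw [this, map_smul, h0, smul_zero]

lemma pick {V : Type} [AddCommGroup V] [Module ℂ V] [FiniteDimensional ℂ V] {W K : Submodule ℂ V}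
    (h : Module.finrank ℂ W + 2 ≤ Module.finrank ℂ K) :
    ∃ s1 ∈ K, ∃ s2 ∈ K, ∀ α β : ℂ, α • s1 + β • s2 ∈ W → α = 0 ∧ β = 0 := by
  obtain ⟨s1, h1, n1⟩ : ∃ s ∈ K, s ∉ W := by
    by_contra hc
    push Not at hc
    have := Submodule.finrank_mono (show K ≤ W from hc)
    omega
  obtain ⟨s2, h2, n2⟩ : ∃ s ∈ K, s ∉ W ⊔ Submodule.span ℂ {s1} := by
    by_contra hc
    push Not at hc
    have := Submodule.finrank_mono (show K ≤ W ⊔ Submodule.span ℂ {s1} from hc)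
    have h3 := Submodule.finrank_add_le_finrank_add_finrank W (Submodule.span ℂ {s1})
    have h4 := finrank_span_le_card (R := ℂ) ({s1} : Set V)
    simp only [Set.toFinset_singleton, Finset.card_singleton] at h4
    omega
  refine ⟨s1, h1, s2, h2, fun α β hab => ?_⟩
  have hβ : β = 0 := by
    by_contra hβ
    apply n2
    rw [← inv_smul_smul₀ hβ s2]
    apply Submodule.smul_mem
    rw [show β • s2 = (α • s1 + β • s2) + (-α) • s1 by module]
    exact Submodule.add_mem_sup hab (Submodule.smul_mem _ _ (Submodule.mem_span_singleton_self _))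
  subst hβ
  refine ⟨?_, rfl⟩
  by_contra hα
  apply n1
  rw [← inv_smul_smul₀ hα s1]
  apply Submodule.smul_mem
  simpa using hab

lemma ch2 (n : ℕ) : (n + 1).choose 2 = n.choose 2 + n := by
  rw [Nat.choose_succ_succ' n 1, Nat.choose_one_right, add_comm]

lemma num1 {f : S} {d d1 d2 : ℕ} (hf : f.IsHomogeneous d) (hd : 2 ≤ d) (hnf : ∀ k, ndim f k ≤ 1)
    (hd1 : IsLeast (mdrSet f) d1) (hsum : d1 + d2 = d) : d1 ≤ d2 := by
  by_contra hlt
  obtain ⟨l, hl, hl0, hreg⟩ := exists_reg f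
  obtain ⟨k, hk⟩ : ∃ k, k + 3 = d + d1 := ⟨d + d1 - 3, by omega⟩
  have h1 := dim_ineq hl hl0 hreg k 1
  have h2 := Ik_le f k
  have h3 := hnf k
  rw [Sgr_finrank, Sgr_finrank] at h1
  have h4 : Module.finrank ℂ (Jk f (k + 1)) = 3 * (d1 + 1).choose 2 := by
    have := rank_null hf (d1 - 1)
    rw [Kk_low hd1 (by omega), show d - 1 + (d1 - 1) = k + 1 by omega,
      show d1 - 1 + 2 = d1 + 1 by omega] at this
    exact this
  have h5 : Module.finrank ℂ (Jk f k) = 3 * d1.choose 2 := by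
    by_cases h1 : d1 = 1
    · rw [Jk_low hf (by omega), h1]; rfl
    · have := rank_null hf (d1 - 2)
      rw [Kk_low hd1 (by omega), show d - 1 + (d1 - 2) = k by omega,
        show d1 - 2 + 2 = d1 by omega] at this
      exact this
  rw [show k + 1 + 2 = (k + 2) + 1 by omega, ch2 (k + 2)] at h1
  rw [ch2] at h4
  omega

lemma num2 {f : S} {d d1 e : ℕ} (hf : f.IsHomogeneous d) (hd : 2 ≤ d) (hnf : ∀ k, ndim f k ≤ 1)
    {r : Fin 3 → S} (hr : r ∈ ARmod f) (hrh : IsHomRel r d1) (hr0 : r ≠ 0)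
    (hsum : d1 + (d1 + e) = d) :
    Module.finrank ℂ (LinearMap.range (mulr hrh e)) + 2 ≤ Module.finrank ℂ (Kk f (d1 + e)) := by
  obtain ⟨l, hl, hl0, hreg⟩ := exists_reg f
  obtain ⟨k, hk⟩ : ∃ k, k + 3 = d + (d1 + e) := ⟨d + (d1 + e) - 3, by omega⟩
  have h1 := dim_ineq hl hl0 hreg k 2
  have h2 := Ik_le f k
  have h3 := hnf k
  rw [Sgr_finrank, Sgr_finrank] at h1
  have h4 := rank_null hf (d1 + e)
  rw [show d - 1 + (d1 + e) = k + 2 by omega] at h4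
  have h5 : Module.finrank ℂ (Jk f k) + e.choose 2 ≤ 3 * (d1 + e).choose 2 := by
    by_cases h1 : d1 + e = 1
    · rw [Jk_low hf (by omega), h1]
      have : e = 0 ∨ e = 1 := by omega
      rcases this with rfl | rfl <;> simp
    · have := rank_null hf (d1 + e - 2)
      rw [show d - 1 + (d1 + e - 2) = k by omega, show d1 + e - 2 + 2 = d1 + e by omega] at this
      have h6 : e.choose 2 ≤ Module.finrank ℂ (Kk f (d1 + e - 2)) := by
        by_cases he : 2 ≤ e
        · obtain ⟨m, rfl⟩ := Nat.exists_eq_add_of_le he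
          have h7 := Submodule.finrank_mono (mulr_le hr hrh m)
          rw [mulr_finrank hrh hr0] at h7
          rw [show d1 + (2 + m) - 2 = d1 + m by omega, add_comm 2 m]
          exact h7
        · rw [Nat.choose_eq_zero_of_lt (by omega)]; omega
      omega
  rw [mulr_finrank hrh hr0]
  have a1 := ch2 (k + 2)
  have a2 := ch2 (k + 3)
  have a3 := ch2 (d1 + e)
  have a4 := ch2 (d1 + e + 1)
  have a5 := ch2 e
  have a6 := ch2 (e + 1)
  rw [show k + 2 + 2 = k + 4 by omega] at h1
  rw [show k + 3 + 1 = k + 4 by omega] at a2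
  rw [show k + 2 + 1 = k + 3 by omega] at a1
  rw [show d1 + e + 1 + 1 = d1 + e + 2 by omega] at a4
  rw [show e + 1 + 1 = e + 2 by omega] at a6
  omega

/-- Structure theorem for nearly free curves. -/
lemma main_thm {f : S} {d d1 d2 : ℕ} (hf : f.IsHomogeneous d) (hd : 2 ≤ d) (hs : Squarefree f)
    (hnf : ∀ k, ndim f k ≤ 1) (hN : ∃ g ∈ Isat f, g ∉ Jf f)
    (hd1 : IsLeast (mdrSet f) d1) (hsum : d1 + d2 = d) (k : ℕ) :
    ((d + d1 ≤ k + 3 ∧ k + 3 ≤ d + d2) → ∃ g ∈ Isat f, g ∈ Sgr k ∧ g ∉ Jf f) ∧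
    ((k + 3 < d + d1 ∨ d + d2 < k + 3) → ∀ g ∈ Isat f, g ∈ Sgr k → g ∈ Jf f) := by
  obtain ⟨e, rfl⟩ := Nat.exists_eq_add_of_le (num1 hf hd hnf hd1 hsum)
  obtain ⟨r, hr, hr0, hrh⟩ := hd1.1
  have hg := grad_prim hf (by omega) hs
  have hrp := r_prim hf hd1 hr hr0 hrh
  obtain ⟨t1, ht1, t2, ht2, hW⟩ := pick (num2 hf hd hnf hr hrh hr0 hsum)
  let s1 : Fin 3 → S := fun i => (t1 i : S)
  let s2 : Fin 3 → S := fun i => (t2 i : S)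
  have h1 : s1 ∈ ARmod f := ht1
  have h2 : s2 ∈ ARmod f := ht2
  have h1h : IsHomRel s1 (d1 + e) := fun i => (t1 i).2
  have h2h : IsHomRel s2 (d1 + e) := fun i => (t2 i).2
  obtain ⟨l1, e1⟩ := phi_exists hg hr h1
  obtain ⟨l2, e2⟩ := phi_exists hg hr h2
  have hlin : ∀ (s : Fin 3 → S) (l : S), IsHomRel s (d1 + e) → crossProduct r s = l • grad f →
      l ∈ Sgr 1 := by
    intro s l hsh hl
    obtain ⟨j, hj⟩ := hg.ne
    refine Sgr_quot (grad_mem hf j) hj ?_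
    have hj2 := congrFun hl j
    rw [Pi.smul_apply, smul_eq_mul] at hj2
    rw [mul_comm, ← hj2, cross_apply, show d - 1 + 1 = d1 + (d1 + e) by omega]
    fin_cases j <;> exact Submodule.sub_mem _ (Sgr_mul (hrh _) (hsh _)) (Sgr_mul (hrh _) (hsh _))
  have hl1 := hlin s1 l1 h1h e1
  have hl2 := hlin s2 l2 h2h e2
  have e1 : Ph f r s1 l1 := e1
  have e2 : Ph f r s2 l2 := e2
  obtain ⟨l3, π, hP⟩ := exists_pencil hl1 hl2 (by
    intro α β hab
    apply hW
    have h3 := (e1.smul (C α)).add (e2.smul (C β))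
    rw [hab] at h3
    obtain ⟨p, hp⟩ := h3.ker hrp
    have hp' : ∀ i, r i * p = C α * (t1 i : S) + C β * (t2 i : S) := by
      intro i
      have := congrFun hp i
      rw [Pi.smul_apply, smul_eq_mul] at this
      rw [mul_comm, ← this]
      rfl
    have hpe : p ∈ Sgr e := by
      obtain ⟨j, hj⟩ := hrp.ne
      refine Sgr_quot (hrh j) hj ?_
      rw [hp']
      exact Submodule.add_mem _ (Sgr_C_mul _ (h1h j)) (Sgr_C_mul _ (h2h j))
    refine ⟨⟨p, hpe⟩, ?_⟩
    funext i
    apply Subtype.ext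
    change r i * p = _
    rw [hp', C_mul', C_mul']
    rfl)
  have := structure_thm hf hd hg hr hrp hrh h1 h2 h1h h2h hP e1 e2 hN k
  rw [add_assoc d d1 e] at this
  exact this

lemma final {f : S} {d : ℕ} (hhom : f.IsHomogeneous d) (hred : Squarefree f)
    (hnf : NearlyFree f) (d1 d2 : ℕ)
    (hd1 : IsLeast (mdrSet f) d1) (hsum : d1 + d2 = d) (k : ℕ) :
      (((d : ℤ) + d1 - 3 ≤ (k : ℤ) ∧ (k : ℤ) ≤ (d : ℤ) + d2 - 3) → ndim f k = 1) ∧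
      (((k : ℤ) < (d : ℤ) + d1 - 3 ∨ (d : ℤ) + d2 - 3 < (k : ℤ)) → ndim f k = 0) := by
  obtain ⟨hN, hle⟩ := hnf
  have hN : ∃ g ∈ Isat f, g ∉ Jf f := by
    by_contra hc
    push Not at hc
    apply hN
    rw [eq_bot_iff]
    rintro _ ⟨g, hg, rfl⟩
    rw [Submodule.mem_bot]
    exact (Submodule.Quotient.mk_eq_zero _).2 (hc g hg)
  have hd : 2 ≤ d := by
    by_contra hlt
    obtain ⟨g, hg, hgJ⟩ := hN
    by_cases h1 : 1 ≤ d
    · have hp := grad_prim hhom h1 hred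
      obtain ⟨j, hj⟩ := hp.ne
      have hjm := grad_mem hhom j
      rw [show d - 1 = 0 by omega] at hjm
      have : grad f j = C (coeff 0 (grad f j)) :=
        totalDegree_eq_zero_iff_eq_C.1 (Nat.le_zero.1 (IsHomogeneous.totalDegree_le hjm))
      have hu : IsUnit (grad f j) := by
        rw [this]
        rw [this] at hj
        refine IsUnit.map _ (isUnit_iff_ne_zero.2 ?_)
        intro h0
        rw [h0] at hj
        exact hj (map_zero _)
      have hJ : grad f j ∈ Jf f := by
        apply Ideal.subset_span
        fin_cases j <;> simp [grad]
      rw [Ideal.eq_top_of_isUnit_mem _ hJ hu] at hgJ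
      exact hgJ trivial
    · have hd0 : d = 0 := by omega
      subst hd0
      have hfC : f = C (coeff 0 f) :=
        totalDegree_eq_zero_iff_eq_C.1 (Nat.le_zero.1 hhom.totalDegree_le)
      have hJ : Jf f = ⊥ := by
        unfold Jf
        rw [hfC]
        simp
      have hIJ : ∀ h ∈ Isat f, h = 0 := by
        intro h hh
        obtain ⟨n, hn⟩ := (mem_Isat f h).1 hh
        have := hn (X 0 ^ n) (Ideal.pow_mem_pow (Sgr1_mId (isHomogeneous_X _ _)) n)
        rw [hJ, Submodule.mem_bot] at this
        exact (mul_eq_zero.1 this).resolve_left (pow_ne_zero _ (X_ne_zero _))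
      apply hgJ
      rw [hIJ g hg]
      exact zero_mem _
  obtain ⟨m1, m2⟩ := main_thm hhom hd hred hle hN hd1 hsum k
  constructor
  · rintro ⟨ha, hb⟩
    obtain ⟨g, hgI, hgk, hgJ⟩ := m1 ⟨by omega, by omega⟩
    apply le_antisymm (hle k)
    have : FiniteDimensional ℂ (Nsub f k) := by
      unfold Nsub
      have : FiniteDimensional ℂ (((Isat f).restrictScalars ℂ ⊓ Sgr k : Submodule ℂ S)) :=
        Submodule.finiteDimensional_of_le (inf_le_right : _ ≤ Sgr k)
      infer_instance
    unfold ndim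
    rw [Nat.one_le_iff_ne_zero, ← Nat.pos_iff_ne_zero, Module.finrank_pos_iff_exists_ne_zero]
    refine ⟨⟨quotC f g, g, ⟨hgI, hgk⟩, rfl⟩, ?_⟩
    intro h0
    exact hgJ (quotC_eq_zero.1 (congrArg Subtype.val h0))
  · intro hor
    have hm := m2 (by omega)
    have : Nsub f k = ⊥ := by
      rw [eq_bot_iff]
      rintro _ ⟨g, ⟨hg, hgk⟩, rfl⟩
      rw [Submodule.mem_bot]
      exact quotC_eq_zero.2 (hm g hg hgk)
    unfold ndim
    rw [this, finrank_bot]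

theorem stmt11 (f : S) (d : ℕ) (hhom : f.IsHomogeneous d) (hred : Squarefree f)
    (hnc : ¬ IsConeOfLines f) (hnf : NearlyFree f) (d1 d2 : ℕ)
    (hd1 : IsLeast (mdrSet f) d1) (hsum : d1 + d2 = d) :
    ∀ k : ℕ,
      (((d : ℤ) + d1 - 3 ≤ (k : ℤ) ∧ (k : ℤ) ≤ (d : ℤ) + d2 - 3) → ndim f k = 1) ∧
      (((k : ℤ) < (d : ℤ) + d1 - 3 ∨ (d : ℤ) + d2 - 3 < (k : ℤ)) → ndim f k = 0) := by
  intro k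
  exact final hhom hred hnf d1 d2 hd1 hsum k

end
end

section
/- Let v1, v2, v3 ∈ S = ℂ[x,y,z] be homogeneous polynomials of positive degrees forming a regular sequence, and suppose that dim_ℂ (S/(v1,v2,v3))_k ≤ 1 for every integer k. Then, up to a permutation of the indices, deg v2 = deg v3 = 1. -/
open MvPolynomial

noncomputable section

def Lc : S →ₗ[ℂ] (Fin 3 → ℂ) :=
  LinearMap.pi fun j => MvPolynomial.lcoeff ℂ (Finsupp.single j 1)

lemma Lc_mul (a b : S) (hb : coeff 0 b = 0) : Lc (a * b) = coeff 0 a • Lc b := by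
  funext j
  simp only [Lc, LinearMap.pi_apply, lcoeff_apply, Pi.smul_apply, smul_eq_mul]
  rw [coeff_mul, Finsupp.antidiagonal_single]
  simp [Finset.Nat.antidiagonal_succ, hb]

lemma Lc_hom (b : S) (n : ℕ) (hb : b ∈ Sgr n) (hn : n ≠ 1) : Lc b = 0 := by
  funext j
  have hb' : b.IsHomogeneous n := hb
  simp only [Lc, LinearMap.pi_apply, lcoeff_apply, Pi.zero_apply]
  apply hb'.coeff_eq_zero
  simpa using hn.symm

lemma Lc_X (j : Fin 3) : Lc (X j : S) = Pi.single j 1 := by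
  funext i
  simp [Lc, lcoeff_apply, coeff_X', Pi.single_apply, Finsupp.single_left_inj, eq_comm]

lemma Lc_surj (w : Fin 3 → ℂ) : ∃ p ∈ Sgr 1, Lc p = w := by
  refine ⟨∑ j, w j • X j, Submodule.sum_mem _ fun j _ =>
    Submodule.smul_mem _ _ (isHomogeneous_X ℂ j), ?_⟩
  simp only [map_sum, map_smul, Lc_X]
  funext i
  simp [Pi.single_apply]

lemma key (v : Fin 3 → S) (e : Fin 3 → ℕ) (hpos : ∀ i, 0 < e i)
    (hhom : ∀ i, v i ∈ Sgr (e i))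
    (hdim : Module.finrank ℂ
      ((Sgr 1).map
        (((Ideal.span (Set.range v) : Submodule S S).mkQ).restrictScalars ℂ)) ≤ 1)
    (i₀ : Fin 3) (h : ∀ j, j ≠ i₀ → e j ≠ 1) : False := by
  set I : Ideal S := Ideal.span (Set.range v) with hI
  set W : Submodule ℂ (Fin 3 → ℂ) := ℂ ∙ Lc (v i₀) with hW
  have h0 : ∀ i, coeff 0 (v i) = 0 := fun i => by
    have hb' : (v i).IsHomogeneous (e i) := hhom i
    apply hb'.coeff_eq_zero
    simpa using (hpos i).ne
  have hIW : ∀ p ∈ I, Lc p ∈ W := by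
    intro p hp
    rw [hI, Ideal.mem_span_range_iff_exists_fun] at hp
    obtain ⟨c, rfl⟩ := hp
    rw [map_sum]
    refine Submodule.sum_mem _ fun j _ => ?_
    rw [Lc_mul _ _ (h0 j)]
    apply Submodule.smul_mem
    by_cases hj : j = i₀
    · subst hj; exact Submodule.mem_span_singleton_self _
    · rw [Lc_hom _ _ (hhom j) (h j hj)]; exact Submodule.zero_mem _
  let φ : (S ⧸ I) →ₗ[ℂ] ((Fin 3 → ℂ) ⧸ W) :=
    ((I.restrictScalars ℂ).liftQ (W.mkQ ∘ₗ Lc) (by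
      intro p hp
      simp only [LinearMap.mem_ker, LinearMap.comp_apply, Submodule.mkQ_apply]
      exact (Submodule.Quotient.mk_eq_zero _).2 (hIW p hp))) ∘ₗ
      (Submodule.Quotient.restrictScalarsEquiv ℂ (I : Submodule S S)).symm.toLinearMap
  set M := (Sgr 1).map (((I : Submodule S S).mkQ).restrictScalars ℂ) with hM
  have hfin : Module.Finite ℂ (Sgr 1) := by
    have : Sgr 1 = Submodule.span ℂ (Set.range (X : Fin 3 → S)) := 
      homogeneousSubmodule_one_eq_span_X
    rw [this]
    exact Module.Finite.span_of_finite ℂ (Set.finite_range _)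
  have hfinM : Module.Finite ℂ M := Module.Finite.map _ _
  have hs : Function.Surjective (φ ∘ₗ M.subtype) := by
    intro y
    obtain ⟨w, rfl⟩ := W.mkQ_surjective y
    obtain ⟨p, hp, rfl⟩ := Lc_surj w
    exact ⟨⟨_, Submodule.mem_map_of_mem hp⟩, rfl⟩
  have h1 := LinearMap.finrank_le_finrank_of_surjective hs
  have h2 := W.finrank_quotient_add_finrank
  have h3 : Module.finrank ℂ W ≤ 1 := by simpa using finrank_span_le_card (R := ℂ) ({Lc (v i₀)} : Set (Fin 3 → ℂ))
  rw [Module.finrank_fin_fun] at h2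
  omega

theorem stmt14 (v : Fin 3 → S) (e : Fin 3 → ℕ) (hpos : ∀ i, 0 < e i)
    (hhom : ∀ i, v i ∈ Sgr (e i))
    (hreg : RingTheory.Sequence.IsRegular S [v 0, v 1, v 2])
    (hdim : ∀ k : ℕ, Module.finrank ℂ
      ((Sgr k).map
        (((Ideal.span (Set.range v) : Submodule S S).mkQ).restrictScalars ℂ)) ≤ 1) :
    ∃ σ : Equiv.Perm (Fin 3), e (σ 1) = 1 ∧ e (σ 2) = 1 := by
  have k := fun i => key v e hpos hhom (hdim 1) i
  have k' : ∀ i, ∃ j, j ≠ i ∧ e j = 1 := fun i => by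
    by_contra hc
    push Not at hc
    exact k i hc
  obtain ⟨a, -, ha⟩ := k' 0
  obtain ⟨b, hb, hb'⟩ := k' a
  have : ∀ a b : Fin 3, b ≠ a → ∃ σ : Equiv.Perm (Fin 3), σ 1 = a ∧ σ 2 = b := by decide
  obtain ⟨σ, h1, h2⟩ := this a b hb
  exact ⟨σ, by rw [h1, ha], by rw [h2, hb']⟩

end
end

section
/- For every integer d ≥ 3, the curve C_d : f = x^d + y^{d−1}z = 0 is nearly free: dim_ℂ N(f)_k = 1 for d−2 ≤ k ≤ 2d−4 and N(f)_k = 0 for all other k. Moreover its total Tjurina number is τ(C_d) = (d−1)(d−2), i.e. m(f)_k = (d−1)(d−2) for all sufficiently large k. -/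
open MvPolynomial

noncomputable section

theorem aux_finrank (f : S) (W : Submodule ℂ S) (A B : (Fin 3 →₀ ℕ) → Prop)
    (T : Finset (Fin 3 →₀ ℕ))
    (hW : ∀ p, p ∈ W ↔ ∀ m ∈ p.support, B m)
    (hJ : ∀ p, p ∈ Jf f ↔ ∀ m ∈ p.support, A m)
    (hT : ∀ m, m ∈ T ↔ B m ∧ ¬ A m) :
    Module.finrank ℂ (W.map (quotC f)) = T.card := by
  classical
  have hq : ∀ p, quotC f p = 0 ↔ p ∈ Jf f := fun p => by
    simp [quotC]
    exact Ideal.Quotient.eq_zero_iff_mem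
  let φ : (T → ℂ) →ₗ[ℂ] S :=
    { toFun := fun c => ∑ t : T, monomial t.1 (c t)
      map_add' := by intro a b; simp [Finset.sum_add_distrib]
      map_smul' := by intro a b; simp [Finset.smul_sum, smul_monomial] }
  have hφ : ∀ c, φ c = ∑ t : T, monomial t.1 (c t) := fun c => rfl
  have hc : ∀ (c : T → ℂ) (t : T), coeff t.1 (φ c) = c t := by
    intro c t
    rw [hφ, coeff_sum, Finset.sum_eq_single t]
    · simp
    · intro b _ hb
      rw [coeff_monomial, if_neg]
      intro h; exact hb (Subtype.ext h)
    · simp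
  have hc' : ∀ (c : T → ℂ) m, m ∉ T → coeff m (φ c) = 0 := by
    intro c m hm
    rw [hφ, coeff_sum]
    refine Finset.sum_eq_zero fun t _ => ?_
    rw [coeff_monomial, if_neg]
    rintro rfl; exact hm t.2
  have hinj : Function.Injective ((quotC f) ∘ₗ φ) := by
    rw [injective_iff_map_eq_zero]
    intro c h
    have h2 := (hJ _).1 ((hq _).1 h)
    funext t
    by_contra hne
    have : t.1 ∈ (φ c).support := by
      rw [mem_support_iff, hc]; exact hne
    exact ((hT _).1 t.2).2 (h2 _ this)
  have hrange : LinearMap.range ((quotC f) ∘ₗ φ) = W.map (quotC f) := by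
    apply le_antisymm
    · rintro _ ⟨c, rfl⟩
      refine ⟨φ c, ?_, rfl⟩
      refine (hW _).2 fun m hm => ?_
      by_contra hB
      exact (mem_support_iff.1 hm) (hc' c m fun h => hB ((hT m).1 h).1)
    · rintro _ ⟨p, hp, rfl⟩
      refine ⟨fun t => coeff t.1 p, ?_⟩
      rw [← sub_eq_zero, LinearMap.comp_apply, ← map_sub, hq, hJ]
      intro m hm
      by_contra hA
      rw [mem_support_iff, coeff_sub] at hm
      by_cases hmT : m ∈ T
      · apply hm
        rw [hc _ ⟨m, hmT⟩, sub_self]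
      · rw [hc' _ m hmT, zero_sub, neg_ne_zero, ← mem_support_iff] at hm
        exact hmT ((hT m).2 ⟨(hW p).1 hp m hm, hA⟩)
  rw [← hrange, LinearMap.finrank_range_of_inj hinj]
  simp

/-- exponent condition for the Jacobian ideal -/
def AJ (d : ℕ) (m : Fin 3 →₀ ℕ) : Prop :=
  d - 1 ≤ m 0 ∨ (d - 2 ≤ m 1 ∧ 1 ≤ m 2) ∨ d - 1 ≤ m 1

theorem aux_X_pow (i : Fin 3) (n : ℕ) : (X i ^ n : S) = monomial (Finsupp.single i n) 1 :=
  X_pow_eq_monomial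

theorem aux_Jf_eq (d : ℕ) (hd : 3 ≤ d) :
    Jf (X 0 ^ d + X 1 ^ (d - 1) * X 2) =
      Ideal.span {X 0 ^ (d-1), X 1 ^ (d-2) * X 2, X 1 ^ (d-1)} := by
  have h0 : pderiv 0 (X 0 ^ d + X 1 ^ (d - 1) * X 2 : S) = C (d : ℂ) * X 0 ^ (d-1) := by
    simp [pderiv_X, Derivation.leibniz_pow]
  have h1 : pderiv 1 (X 0 ^ d + X 1 ^ (d - 1) * X 2 : S)
      = C ((d - 1 : ℕ) : ℂ) * (X 1 ^ (d-2) * X 2) := by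
    have : d - 1 - 1 = d - 2 := by omega
    simp [pderiv_X, Derivation.leibniz_pow, this]
    ring
  have h2 : pderiv 2 (X 0 ^ d + X 1 ^ (d - 1) * X 2 : S) = X 1 ^ (d-1) := by
    simp [pderiv_X, Derivation.leibniz_pow]
  have hu : ∀ n : ℕ, n ≠ 0 → IsUnit (C (n : ℂ) : S) := fun n hn =>
    (IsUnit.mk0 (n : ℂ) (by exact_mod_cast hn)).map C
  unfold Jf
  rw [h0, h1, h2, Ideal.span_insert, Ideal.span_insert (C _ * _), Ideal.span_insert (X 0 ^ _),
    Ideal.span_insert (X 1 ^ _ * _),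
    Ideal.span_singleton_mul_left_unit (hu d (by omega)),
    Ideal.span_singleton_mul_left_unit (hu (d-1) (by omega))]

theorem aux_le_single (i : Fin 3) (n : ℕ) (m : Fin 3 →₀ ℕ) :
    Finsupp.single i n ≤ m ↔ n ≤ m i := by
  simp

theorem aux_mem_Jf (d : ℕ) (hd : 3 ≤ d) (p : S) :
    p ∈ Jf (X 0 ^ d + X 1 ^ (d - 1) * X 2) ↔ ∀ m ∈ p.support, AJ d m := by
  have : ({X 0 ^ (d-1), X 1 ^ (d-2) * X 2, X 1 ^ (d-1)} : Set S) =
      (fun s => monomial s (1 : ℂ)) '' {Finsupp.single 0 (d-1),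
        Finsupp.single 1 (d-2) + Finsupp.single 2 1, Finsupp.single 1 (d-1)} := by
    simp only [Set.image_insert_eq, Set.image_singleton, aux_X_pow]
    congr 2
    rw [X, monomial_mul, one_mul]
  rw [aux_Jf_eq d hd, this, mem_ideal_span_monomial_image]
  refine forall₂_congr fun m _ => ?_
  have h2 : Finsupp.single 1 (d-2) + Finsupp.single 2 1 ≤ m ↔ (d - 2 ≤ m 1 ∧ 1 ≤ m 2) := by
    rw [Finsupp.le_def]
    simp [Fin.forall_fin_succ, Finsupp.single_apply]
  simp only [Set.mem_insert_iff, Set.mem_singleton_iff, exists_eq_or_imp, exists_eq_left,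
    aux_le_single, h2, AJ]

theorem aux_mem_Isat (d : ℕ) (hd : 3 ≤ d) (p : S) :
    p ∈ Isat (X 0 ^ d + X 1 ^ (d - 1) * X 2) ↔
      ∀ m ∈ p.support, d - 1 ≤ m 0 ∨ d - 2 ≤ m 1 := by
  have hI : ({X 0 ^ (d-1), X 1 ^ (d-2)} : Set S) =
      (fun s => monomial s (1 : ℂ)) '' {Finsupp.single 0 (d-1), Finsupp.single 1 (d-2)} := by
    simp only [Set.image_insert_eq, Set.image_singleton, aux_X_pow]
  have hI2 : p ∈ Ideal.span ({X 0 ^ (d-1), X 1 ^ (d-2)} : Set S) ↔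
      ∀ m ∈ p.support, d - 1 ≤ m 0 ∨ d - 2 ≤ m 1 := by
    rw [hI, mem_ideal_span_monomial_image]
    refine forall₂_congr fun m _ => ?_
    simp only [Set.mem_insert_iff, Set.mem_singleton_iff, exists_eq_or_imp, exists_eq_left,
      aux_le_single]
  constructor
  · rw [← hI2]
    clear hI2
    revert p
    change Isat _ ≤ _
    refine iSup_le fun n p hp => ?_
    rw [Submodule.mem_colon] at hp
    have h := hp (X 2 ^ n) (Ideal.pow_mem_pow (Ideal.subset_span (by simp)) n)
    have h' := (aux_mem_Jf d hd _).1 h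
    rw [hI, mem_ideal_span_monomial_image]
    intro m hm
    simp only [Set.mem_insert_iff, Set.mem_singleton_iff, exists_eq_or_imp, exists_eq_left,
      aux_le_single]
    have := h' (m + Finsupp.single 2 n) (by
      rw [mem_support_iff, smul_eq_mul, aux_X_pow, coeff_mul_monomial, mul_one]
      exact mem_support_iff.1 hm)
    simp [AJ, Finsupp.single_apply] at this
    omega
  · rw [← hI2]
    intro h
    refine Ideal.span_le.2 ?_ h
    rintro q hq
    have hJ := aux_Jf_eq d hd
    rcases hq with rfl | hq
    · refine (le_iSup (fun n : ℕ => Submodule.colon (Jf _)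
        ((mId ^ n : Ideal S) : Submodule S S)) 0) ?_
      rw [Submodule.mem_colon]
      intro s _
      exact Ideal.mul_mem_right _ _ (by rw [hJ]; exact Ideal.subset_span (by simp))
    · rw [Set.mem_singleton_iff] at hq
      subst hq
      refine (le_iSup (fun n : ℕ => Submodule.colon (Jf _)
        ((mId ^ n : Ideal S) : Submodule S S)) (d - 1 + 1)) ?_
      rw [Submodule.mem_colon]
      intro s hs
      have hs' : s ∈ Ideal.span {(X 0 : S)} ^ (d-1) ⊔ Ideal.span {(X 1 : S), X 2} ^ 1 := by
        apply Ideal.sup_pow_add_le_pow_sup_pow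
        rw [← Ideal.span_insert]
        exact hs
      rw [Ideal.span_singleton_pow, pow_one] at hs'
      obtain ⟨a, ha, b, hb, rfl⟩ := Submodule.mem_sup.1 hs'
      obtain ⟨u, rfl⟩ := Ideal.mem_span_singleton.1 ha
      obtain ⟨v, w, rfl⟩ := Ideal.mem_span_pair.1 hb
      rw [hJ]
      have e : (X 1 ^ (d-2) : S) • (X 0 ^ (d-1) * u + (v * X 1 + w * X 2)) =
        (X 1 ^ (d-2) * u) * X 0 ^ (d-1) + v * X 1 ^ (d-1) + w * (X 1 ^ (d-2) * X 2) := by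
        have : d - 1 = d - 2 + 1 := by omega
        rw [smul_eq_mul, this, pow_succ (X 1)]
        ring
      rw [e]
      refine Ideal.add_mem _ (Ideal.add_mem _ ?_ ?_) ?_ <;>
      exact Ideal.mul_mem_left _ _ (Ideal.subset_span (by simp))

theorem aux_mem_Sgr (k : ℕ) (p : S) :
    p ∈ Sgr k ↔ ∀ m ∈ p.support, m 0 + m 1 + m 2 = k := by
  rw [Sgr, mem_homogeneousSubmodule, IsHomogeneous, IsWeightedHomogeneous]
  refine forall_congr' fun m => ?_
  rw [mem_support_iff]
  refine imp_congr Iff.rfl ?_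
  rw [show (1 : Fin 3 → ℕ) = fun _ => 1 from rfl, ← Finsupp.degree_eq_weight_one, Finsupp.degree_eq_sum, Fin.sum_univ_three]

theorem aux_ndim (d : ℕ) (hd : 3 ≤ d) (k : ℕ) (T : Finset (Fin 3 →₀ ℕ))
    (hT : ∀ m, m ∈ T ↔ ((d - 1 ≤ m 0 ∨ d - 2 ≤ m 1) ∧ m 0 + m 1 + m 2 = k) ∧ ¬ AJ d m) :
    ndim (X 0 ^ d + X 1 ^ (d - 1) * X 2) k = T.card := by
  refine aux_finrank _ _ (AJ d)
    (fun m => (d - 1 ≤ m 0 ∨ d - 2 ≤ m 1) ∧ m 0 + m 1 + m 2 = k) T ?_ (aux_mem_Jf d hd) hT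
  intro p
  rw [Submodule.mem_inf, Submodule.restrictScalars_mem, aux_mem_Isat d hd, aux_mem_Sgr]
  exact ⟨fun h m hm => ⟨h.1 m hm, h.2 m hm⟩, fun h => ⟨fun m hm => (h m hm).1, fun m hm => (h m hm).2⟩⟩

theorem aux_mdim (d : ℕ) (hd : 3 ≤ d) (k : ℕ) (T : Finset (Fin 3 →₀ ℕ))
    (hT : ∀ m, m ∈ T ↔ (m 0 + m 1 + m 2 = k) ∧ ¬ AJ d m) :
    mdim (X 0 ^ d + X 1 ^ (d - 1) * X 2) k = T.card :=
  aux_finrank _ _ (AJ d) (fun m => m 0 + m 1 + m 2 = k) T (aux_mem_Sgr k) (aux_mem_Jf d hd) hT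

/-- the exponent `(a,b,c)` -/
def expo (a b c : ℕ) : Fin 3 →₀ ℕ := Finsupp.equivFunOnFinite.symm ![a, b, c]

theorem eq_expo (m : Fin 3 →₀ ℕ) (a b c : ℕ) :
    m = expo a b c ↔ m 0 = a ∧ m 1 = b ∧ m 2 = c := by
  rw [Finsupp.ext_iff]
  simp [Fin.forall_fin_succ, expo]

theorem aux_ndim_one (d : ℕ) (hd : 3 ≤ d) (k : ℕ) (h1 : d - 2 ≤ k) (h2 : k ≤ 2 * d - 4) :
    ndim (X 0 ^ d + X 1 ^ (d - 1) * X 2) k = 1 := by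
  rw [aux_ndim d hd k {expo (k - (d-2)) (d-2) 0}]
  · simp
  · intro m
    rw [Finset.mem_singleton, eq_expo, AJ]
    omega

theorem aux_ndim_zero (d : ℕ) (hd : 3 ≤ d) (k : ℕ) (h : k < d - 2 ∨ 2 * d - 4 < k) :
    ndim (X 0 ^ d + X 1 ^ (d - 1) * X 2) k = 0 := by
  rw [aux_ndim d hd k ∅]
  · simp
  · intro m
    simp only [Finset.notMem_empty, AJ, false_iff]
    rintro ⟨⟨h1, h2⟩, h3⟩
    omega

theorem aux_tjurina (d : ℕ) (hd : 3 ≤ d) (k : ℕ) (hk : 2 * d ≤ k) :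
    mdim (X 0 ^ d + X 1 ^ (d - 1) * X 2) k = (d - 1) * (d - 2) := by
  classical
  rw [aux_mdim d hd k ((Finset.range (d-1) ×ˢ Finset.range (d-2)).image
    (fun q => expo q.1 q.2 (k - q.1 - q.2)))]
  · rw [Finset.card_image_of_injective]
    · simp
    · rintro ⟨a, b⟩ ⟨a', b'⟩ h
      have := (eq_expo _ _ _ _).1 h
      simp [expo] at this
      simp [this]
  · intro m
    simp only [Finset.mem_image, Finset.mem_product, Finset.mem_range, Prod.exists, AJ]
    constructor
    · rintro ⟨a, b, h, h'⟩
      have := (eq_expo _ _ _ _).1 h'.symm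
      omega
    · intro h
      refine ⟨m 0, m 1, by omega, ?_⟩
      symm
      rw [eq_expo]
      omega

theorem stmt15 (d : ℕ) (hd : 3 ≤ d) (f : S)
    (hf : f = X 0 ^ d + X 1 ^ (d - 1) * X 2) :
    NearlyFree f ∧
    (∀ k : ℕ, (d - 2 ≤ k ∧ k ≤ 2 * d - 4 → ndim f k = 1) ∧
      ((k < d - 2 ∨ 2 * d - 4 < k) → ndim f k = 0)) ∧
    TjurinaIs f ((d - 1) * (d - 2)) := by
  subst hf
  refine ⟨⟨?_, ?_⟩, ?_, ⟨2 * d, fun k hk => aux_tjurina d hd k hk⟩⟩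
  · intro h
    have h1 := aux_ndim_one d hd (d - 2) le_rfl (by omega)
    have h0 : Nsub (X 0 ^ d + X 1 ^ (d - 1) * X 2) (d - 2) = ⊥ := by
      rw [eq_bot_iff]
      rintro _ ⟨p, hp, rfl⟩
      have : (Jf (X 0 ^ d + X 1 ^ (d - 1) * X 2)).mkQ p ∈ Nmod (X 0 ^ d + X 1 ^ (d - 1) * X 2) :=
        ⟨p, hp.1, rfl⟩
      rw [h] at this
      exact this
    rw [ndim, h0] at h1
    simp at h1
  · intro k
    by_cases hk : d - 2 ≤ k ∧ k ≤ 2 * d - 4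
    · exact (aux_ndim_one d hd k hk.1 hk.2).le
    · rw [aux_ndim_zero d hd k (by omega)]
      exact zero_le_one
  · exact fun k => ⟨fun h => aux_ndim_one d hd k h.1 h.2, aux_ndim_zero d hd k⟩

end
end
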